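/- arXiv:2302.07383 — 8 statements merged into one kernel-verified Lean document; each statement's English description precedes it below -/
import Mathlib

section
/- Under (A2.1) and (A2.2), with C nonempty and compact, the following hold: (a) the topological interior of C equals ⋂_{i=1}^r {x ∈ ℝⁿ : ψ_i(x) < 0} and is nonempty; (b) the topological boundary of C equals C ∩ (⋃_{i=1}^r bdry C_i) and is nonempty; (c) C equals the closure of its interior. -/
open Metric Set
open scoped BigOperators

noncomputable section

open Filter Topology

/-- A function decreases along any direction making a negative inner product with its gradient. -/
lemma HasGradientAt.eventually_lt_of_inner_neg {E : Type*} [NormedAddCommGroup E]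
    [InnerProductSpace ℝ E] [CompleteSpace E] {f : E → ℝ} {g c d : E}
    (hf : HasGradientAt f g c) (hd : inner ℝ g d < 0) :
    ∀ᶠ t : ℝ in 𝓝[>] 0, f (c + t • d) < f c := by
  have hline : HasDerivAt (fun t : ℝ => c + t • d) d 0 := by
    simpa using ((hasDerivAt_id (0 : ℝ)).smul_const d).const_add c
  have hcomp : HasDerivAt (fun t : ℝ => f (c + t • d)) (inner ℝ g d) 0 := by
    have hf' : HasFDerivAt f (InnerProductSpace.toDual ℝ E g) (c + (0 : ℝ) • d) := by
      simpa using hf.hasFDerivAt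
    simpa [Function.comp_def] using hf'.comp_hasDerivAt (0 : ℝ) hline
  filter_upwards [hcomp.tendsto_slope_zero_right.eventually_lt_const hd, self_mem_nhdsWithin]
    with t ht htpos
  have htpos' : 0 < t := htpos
  simp only [zero_add, zero_smul, add_zero, smul_eq_mul] at ht
  have := (inv_pos.2 htpos').le
  by_contra! h
  nlinarith [mul_nonneg this (sub_nonneg.2 h)]

/-- A function increases in the direction of its gradient. -/
lemma HasGradientAt.eventually_gt_of_ne_zero {E : Type*} [NormedAddCommGroup E]
    [InnerProductSpace ℝ E] [CompleteSpace E] {f : E → ℝ} {g c : E}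
    (hf : HasGradientAt f g c) (hg : g ≠ 0) :
    ∀ᶠ t : ℝ in 𝓝[>] 0, f c < f (c + t • g) := by
  have hneg : HasGradientAt (fun x => -f x) (-g) c := by
    rw [hasGradientAt_iff_hasFDerivAt, map_neg]
    exact hf.hasFDerivAt.neg
  have hinner : inner ℝ (-g) g < 0 := by
    rw [inner_neg_left, neg_lt_zero]
    exact real_inner_self_pos.2 hg
  filter_upwards [hneg.eventually_lt_of_inner_neg hinner] with t ht
  linarith

lemma tendsto_add_smul_nhdsGT_zero {E : Type*} [NormedAddCommGroup E] [NormedSpace ℝ E]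
    (c d : E) : Tendsto (fun t : ℝ => c + t • d) (𝓝[>] 0) (𝓝 c) := by
  have h : Continuous fun t : ℝ => c + t • d := by fun_prop
  simpa using (h.tendsto 0).mono_left nhdsWithin_le_nhds

/-- A finite family of vectors with no vanishing convex combination lies in an open half-space
through the origin. -/
lemma exists_forall_inner_neg_of_convexCombination_ne_zero {E ι : Type*} [Fintype ι]
    [NormedAddCommGroup E] [InnerProductSpace ℝ E] [CompleteSpace E] (g : ι → E) (s : Set ι)
    (h : ∀ w : ι → ℝ, (∀ i, 0 ≤ w i) → (∀ i ∉ s, w i = 0) → ∑ i, w i = 1 →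
      ∑ i, w i • g i ≠ 0) :
    ∃ d : E, ∀ i ∈ s, inner ℝ (g i) d < 0 := by
  classical
  let W : Submodule ℝ (ι → ℝ) :=
    { carrier := {w | ∀ i ∉ s, w i = 0}
      add_mem' := fun ha hb i hi => by simp [ha i hi, hb i hi]
      zero_mem' := fun _ _ => rfl
      smul_mem' := fun c w hw i hi => by simp [hw i hi] }
  let T : (ι → ℝ) →ₗ[ℝ] E := Fintype.linearCombination ℝ g
  have hT : ∀ w, T w = ∑ i, w i • g i := fun w => Fintype.linearCombination_apply ℝ g w
  have hconv : Convex ℝ (T '' (stdSimplex ℝ ι ∩ W)) :=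
    ((convex_stdSimplex ℝ ι).inter W.convex).linear_image T
  have hclosed : IsClosed (T '' (stdSimplex ℝ ι ∩ W)) :=
    (((isCompact_stdSimplex ℝ ι).inter_right W.closed_of_finiteDimensional).image
      T.continuous_of_finiteDimensional).isClosed
  have hzero : (0 : E) ∉ T '' (stdSimplex ℝ ι ∩ W) := by
    rintro ⟨w, ⟨hw, hws⟩, hw0⟩
    exact h w hw.1 hws hw.2 (by rw [← hT, hw0])
  obtain ⟨f, u, hu, hf⟩ := geometric_hahn_banach_point_closed hconv hclosed hzero
  refine ⟨-(InnerProductSpace.toDual ℝ E).symm f, fun i hi => ?_⟩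
  have hgi : g i ∈ T '' (stdSimplex ℝ ι ∩ W) := by
    refine ⟨Pi.single i 1, ⟨single_mem_stdSimplex ℝ i, fun j hj => ?_⟩, ?_⟩
    · exact Pi.single_eq_of_ne (by rintro rfl; exact hj hi) _
    · simp [T]
  have := hf _ hgi
  rw [map_zero] at hu
  rw [inner_neg_right, real_inner_comm, InnerProductSpace.toDual_symm_apply]
  linarith

theorem stmt_0 {n r : ℕ} (hn : 0 < n) (hr : 0 < r)
    (ψ : Fin r → EuclideanSpace ℝ (Fin n) → ℝ)
    (ψ' : Fin r → EuclideanSpace ℝ (Fin n) → EuclideanSpace ℝ (Fin n))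
    (C : Set (EuclideanSpace ℝ (Fin n)))
    (hCdef : C = ⋂ i, {x | ψ i x ≤ 0})
    (hCne : C.Nonempty) (hCcp : IsCompact C)
    -- (A2.1)
    (ρ : ℝ) (hρ : 0 < ρ)
    (hdiff : ∀ i, ∀ x ∈ {y | ∃ c ∈ C, dist y c < ρ}, HasGradientAt (ψ i) (ψ' i x) x)
    (hlip : ∀ i, ∃ L : NNReal, LipschitzOnWith L (ψ' i) {y | ∃ c ∈ C, dist y c < ρ})
    -- (A2.2)
    (η : ℝ) (hη : 0 < η)
    (hA22 : ∀ c ∈ C, ∀ lam : Fin r → ℝ, (∀ i, 0 ≤ lam i) →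
      (∀ i, ψ i c ≠ 0 → lam i = 0) → (∑ i, lam i) = 1 →
      2 * η < ‖∑ i, lam i • ψ' i c‖) :
    interior C = (⋂ i, {x | ψ i x < 0}) ∧ (interior C).Nonempty ∧
    frontier C = C ∩ (⋃ i, frontier {x | ψ i x ≤ 0}) ∧ (frontier C).Nonempty ∧
    C = closure (interior C) := by
  have hmem : ∀ x, x ∈ C ↔ ∀ i, ψ i x ≤ 0 := fun x => by simp [hCdef]
  have hgrad : ∀ c ∈ C, ∀ i, HasGradientAt (ψ i) (ψ' i c) c := fun c hc i =>
    hdiff i c ⟨c, hc, by simpa using hρ⟩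
  have hcont : ∀ c ∈ C, ∀ i, ContinuousAt (ψ i) c := fun c hc i =>
    (hgrad c hc i).continuousAt
  have hinactive : ∀ c ∈ C, ∀ i, ψ i c < 0 → ∀ᶠ y in 𝓝 c, ψ i y < 0 := fun c hc i hi =>
    (hcont c hc i).eventually_lt_const hi
  have hactive : ∀ c ∈ C, ∀ i, ψ i c = 0 → c ∉ interior {x | ψ i x ≤ 0} := by
    intro c hc i hi hint
    have hne : ψ' i c ≠ 0 := by
      intro h0
      have := hA22 c hc (Pi.single i 1) (single_mem_stdSimplex ℝ i).1
        (fun j hj => Pi.single_eq_of_ne (by rintro rfl; exact hj hi) _)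
        (single_mem_stdSimplex ℝ i).2
      simp [Pi.single_apply, h0] at this
      linarith
    obtain ⟨t, ht, ht'⟩ := (((hgrad c hc i).eventually_gt_of_ne_zero hne).and
      ((tendsto_add_smul_nhdsGT_zero c (ψ' i c)).eventually
        (mem_interior_iff_mem_nhds.1 hint))).exists
    have ht'' : ψ i (c + t • ψ' i c) ≤ 0 := ht'
    linarith
  have hint : interior C = ⋂ i, {x | ψ i x < 0} := by
    ext x
    simp only [mem_iInter, mem_ofPred_eq]
    constructor
    · intro hx i
      have hxC := interior_subset hx
      refine lt_of_le_of_ne ((hmem x).1 hxC i) fun h0 => hactive x hxC i h0 ?_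
      exact interior_mono (fun y hy => (hmem y).1 hy i) hx
    · intro hx
      have hxC : x ∈ C := (hmem x).2 fun i => (hx i).le
      rw [mem_interior_iff_mem_nhds]
      filter_upwards [eventually_all.2 fun i => hinactive x hxC i (hx i)] with y hy
      exact (hmem y).2 fun i => (hy i).le
  have hdense : C ⊆ closure (interior C) := by
    intro c hc
    obtain ⟨d, hd⟩ := exists_forall_inner_neg_of_convexCombination_ne_zero
      (fun i => ψ' i c) {i | ψ i c = 0} fun w hw hws hsum h0 => by
        have := hA22 c hc w hw hws hsum
        rw [h0, norm_zero] at this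
        linarith
    refine mem_closure_of_tendsto (tendsto_add_smul_nhdsGT_zero c d) ?_
    rw [hint]
    simp only [mem_iInter, mem_ofPred_eq]
    refine eventually_all.2 fun i => ?_
    rcases ((hmem c).1 hc i).lt_or_eq with hi | hi
    · exact (tendsto_add_smul_nhdsGT_zero c d).eventually (hinactive c hc i hi)
    · simpa only [hi] using (hgrad c hc i).eventually_lt_of_inner_neg (hd i hi)
  have hfrontier : frontier C = C ∩ ⋃ i, frontier {x | ψ i x ≤ 0} := by
    rw [hCcp.isClosed.frontier_eq, hint]
    ext x
    simp only [Set.mem_sdiff, mem_inter_iff, mem_iInter, mem_iUnion, mem_ofPred_eq, not_forall]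
    refine and_congr_right fun hx => exists_congr fun i => ?_
    constructor
    · intro hi
      have hle := (hmem x).1 hx i
      exact ⟨subset_closure hle, hactive x hx i (le_antisymm hle (not_lt.1 hi))⟩
    · intro hi hlt
      refine hi.2 (mem_interior_iff_mem_nhds.2 ?_)
      filter_upwards [hinactive x hx i hlt] with y hy using hy.le
  refine ⟨hint, ?_, hfrontier, ?_, ?_⟩
  · exact closure_nonempty_iff.1 (hCne.mono hdense)
  · have : Nonempty (Fin n) := ⟨⟨0, hn⟩⟩
    rw [nonempty_frontier_iff]
    exact ⟨hCne, fun h => noncompact_univ (EuclideanSpace ℝ (Fin n)) (h ▸ hCcp)⟩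
  · exact hdense.antisymm (hCcp.isClosed.closure_subset_iff.2 interior_subset)
end
end

section
/- Under (A2.1) and (A2.2), with C nonempty and compact, there exist Γ > 0 and r₁ > 0 with 2r₁ ≤ ρ such that for every γ ≥ Γ, every x ∈ ℝⁿ with ψ_γ(x) = 0, and every z with ‖z − x‖ < 2r₁, one has ‖∇ψ_γ(z)‖ > 2η. In particular, for γ ≥ Γ, ψ_γ(x) = 0 implies ‖∇ψ_γ(x)‖ > 2η. -/
open Metric Set
open scoped BigOperators

noncomputable section

/-- The log-exponential approximation `ψ_γ`. -/
def psiG {n r : ℕ} (ψ : Fin r → EuclideanSpace ℝ (Fin n) → ℝ) (γ : ℝ)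
    (x : EuclideanSpace ℝ (Fin n)) : ℝ :=
  (1 / γ) * Real.log (∑ i, Real.exp (γ * ψ i x))

/-- The formula for the gradient of `ψ_γ`. -/
def gradPsiG {n r : ℕ} (ψ : Fin r → EuclideanSpace ℝ (Fin n) → ℝ)
    (ψ' : Fin r → EuclideanSpace ℝ (Fin n) → EuclideanSpace ℝ (Fin n)) (γ : ℝ)
    (x : EuclideanSpace ℝ (Fin n)) : EuclideanSpace ℝ (Fin n) :=
  (∑ i, Real.exp (γ * ψ i x))⁻¹ • ∑ i, Real.exp (γ * ψ i x) • ψ' i x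

open Filter Topology

/-- Exponentials of a sequence with negative limit vanish when scaled by a divergent factor. -/
lemma tendsto_exp_mul_zero_of_neg {γ f : ℕ → ℝ} {a : ℝ} (hγ : Tendsto γ atTop atTop)
    (hf : Tendsto f atTop (𝓝 a)) (ha : a < 0) :
    Tendsto (fun k => Real.exp (γ k * f k)) atTop (𝓝 0) :=
  Real.tendsto_exp_atBot.comp (hγ.atTop_mul_neg ha hf)

/-- The zero level set of `ψ_γ` consists of the points where the exponentials sum to one. -/
lemma sum_exp_eq_one_of_psiG_eq_zero {n r : ℕ} (hr : 0 < r)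
    {ψ : Fin r → EuclideanSpace ℝ (Fin n) → ℝ} {γ : ℝ} (hγ : 0 < γ)
    {x : EuclideanSpace ℝ (Fin n)} (hx : psiG ψ γ x = 0) :
    ∑ i, Real.exp (γ * ψ i x) = 1 := by
  have hne : (Finset.univ : Finset (Fin r)).Nonempty := ⟨⟨0, hr⟩, Finset.mem_univ _⟩
  have hpos : 0 < ∑ i, Real.exp (γ * ψ i x) := Finset.sum_pos (fun i _ => Real.exp_pos _) hne
  have hlog : Real.log (∑ i, Real.exp (γ * ψ i x)) = 0 := by
    rcases mul_eq_zero.mp hx with h | h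
    · exact absurd h (by positivity)
    · exact h
  exact Real.eq_one_of_pos_of_log_eq_zero hpos hlog

/-- Each function is nonpositive on the zero level set of `ψ_γ`. -/
lemma nonpos_of_psiG_eq_zero {n r : ℕ} (hr : 0 < r)
    {ψ : Fin r → EuclideanSpace ℝ (Fin n) → ℝ} {γ : ℝ} (hγ : 0 < γ)
    {x : EuclideanSpace ℝ (Fin n)} (hx : psiG ψ γ x = 0) (i : Fin r) : ψ i x ≤ 0 := by
  have h : Real.exp (γ * ψ i x) ≤ 1 := by
    rw [← sum_exp_eq_one_of_psiG_eq_zero hr hγ hx]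
    exact Finset.single_le_sum (f := fun i => Real.exp (γ * ψ i x))
      (fun j _ => (Real.exp_pos _).le) (Finset.mem_univ i)
  exact nonpos_of_mul_nonpos_right (Real.exp_le_one_iff.mp h) hγ

/-- The softmax weights of the values `ψ i x` at inverse temperature `γ`. -/
def softmaxWeight {n r : ℕ} (ψ : Fin r → EuclideanSpace ℝ (Fin n) → ℝ) (γ : ℝ)
    (x : EuclideanSpace ℝ (Fin n)) (i : Fin r) : ℝ :=
  (∑ j, Real.exp (γ * ψ j x))⁻¹ * Real.exp (γ * ψ i x)

lemma softmaxWeight_mem_stdSimplex {n r : ℕ} (hr : 0 < r)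
    (ψ : Fin r → EuclideanSpace ℝ (Fin n) → ℝ) (γ : ℝ) (x : EuclideanSpace ℝ (Fin n)) :
    softmaxWeight ψ γ x ∈ stdSimplex ℝ (Fin r) := by
  have hne : (Finset.univ : Finset (Fin r)).Nonempty := ⟨⟨0, hr⟩, Finset.mem_univ _⟩
  have hpos : 0 < ∑ i, Real.exp (γ * ψ i x) := Finset.sum_pos (fun i _ => Real.exp_pos _) hne
  refine ⟨fun i => ?_, ?_⟩
  · unfold softmaxWeight
    positivity
  · simp only [softmaxWeight]
    rw [← Finset.mul_sum, inv_mul_cancel₀ hpos.ne']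

lemma softmaxWeight_le_exp {n r : ℕ} (ψ : Fin r → EuclideanSpace ℝ (Fin n) → ℝ) (γ : ℝ)
    (x : EuclideanSpace ℝ (Fin n)) (i j : Fin r) :
    softmaxWeight ψ γ x i ≤ Real.exp (γ * (ψ i x - ψ j x)) := by
  have h : Real.exp (γ * ψ j x) ≤ ∑ k, Real.exp (γ * ψ k x) :=
    Finset.single_le_sum (f := fun i => Real.exp (γ * ψ i x))
      (fun k _ => (Real.exp_pos _).le) (Finset.mem_univ j)
  rw [softmaxWeight, mul_sub, Real.exp_sub, inv_mul_eq_div]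
  gcongr

lemma gradPsiG_eq_sum_softmaxWeight {n r : ℕ} (ψ : Fin r → EuclideanSpace ℝ (Fin n) → ℝ)
    (ψ' : Fin r → EuclideanSpace ℝ (Fin n) → EuclideanSpace ℝ (Fin n)) (γ : ℝ)
    (x : EuclideanSpace ℝ (Fin n)) :
    gradPsiG ψ ψ' γ x = ∑ i, softmaxWeight ψ γ x i • ψ' i x := by
  simp only [gradPsiG, softmaxWeight, Finset.smul_sum, smul_smul]

/-- A limit, as `γ → ∞`, of points in the zero level sets of `ψ_γ` has an active index. -/
lemma exists_active_of_tendsto {n r : ℕ} (hr : 0 < r)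
    {ψ : Fin r → EuclideanSpace ℝ (Fin n) → ℝ} {γ : ℕ → ℝ} {x : ℕ → EuclideanSpace ℝ (Fin n)}
    {c : EuclideanSpace ℝ (Fin n)} (hγ : Tendsto γ atTop atTop) (hγpos : ∀ k, 0 < γ k)
    (hx : ∀ k, psiG ψ (γ k) (x k) = 0) (hxc : Tendsto x atTop (𝓝 c))
    (hcont : ∀ i, ContinuousAt (ψ i) c) (hc : ∀ i, ψ i c ≤ 0) : ∃ j, ψ j c = 0 := by
  by_contra! hne
  have hlim : Tendsto (fun k => ∑ i, Real.exp (γ k * ψ i (x k))) atTop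
      (𝓝 (∑ _i : Fin r, (0 : ℝ))) :=
    tendsto_finsetSum _ fun i _ => tendsto_exp_mul_zero_of_neg hγ ((hcont i).tendsto.comp hxc)
      (lt_of_le_of_ne (hc i) (hne i))
  simp only [fun k => sum_exp_eq_one_of_psiG_eq_zero hr (hγpos k) (hx k),
    Finset.sum_const_zero] at hlim
  exact one_ne_zero (tendsto_nhds_unique tendsto_const_nhds hlim)

/-- Softmax weights of functions that are not maximal at `c` vanish in the limit. -/
lemma tendsto_softmaxWeight_zero {n r : ℕ}
    {ψ : Fin r → EuclideanSpace ℝ (Fin n) → ℝ} {γ : ℕ → ℝ} {z : ℕ → EuclideanSpace ℝ (Fin n)}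
    {c : EuclideanSpace ℝ (Fin n)} (hγ : Tendsto γ atTop atTop) (hzc : Tendsto z atTop (𝓝 c))
    (hcont : ∀ i, ContinuousAt (ψ i) c) {i j : Fin r} (hij : ψ i c < ψ j c) :
    Tendsto (fun k => softmaxWeight ψ (γ k) (z k) i) atTop (𝓝 0) := by
  refine squeeze_zero
    (fun k => (softmaxWeight_mem_stdSimplex i.pos ψ (γ k) (z k)).1 i)
    (fun k => softmaxWeight_le_exp ψ (γ k) (z k) i j) ?_
  exact tendsto_exp_mul_zero_of_neg hγ
    (((hcont i).tendsto.comp hzc).sub ((hcont j).tendsto.comp hzc)) (sub_neg.mpr hij)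

theorem stmt_2 {n r : ℕ} (hn : 0 < n) (hr : 0 < r)
    (ψ : Fin r → EuclideanSpace ℝ (Fin n) → ℝ)
    (ψ' : Fin r → EuclideanSpace ℝ (Fin n) → EuclideanSpace ℝ (Fin n))
    (C : Set (EuclideanSpace ℝ (Fin n)))
    (hCdef : C = ⋂ i, {x | ψ i x ≤ 0})
    (hCne : C.Nonempty) (hCcp : IsCompact C)
    -- (A2.1)
    (ρ : ℝ) (hρ : 0 < ρ)
    (hdiff : ∀ i, ∀ x ∈ {y | ∃ c ∈ C, dist y c < ρ}, HasGradientAt (ψ i) (ψ' i x) x)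
    (hlip : ∀ i, ∃ L : NNReal, LipschitzOnWith L (ψ' i) {y | ∃ c ∈ C, dist y c < ρ})
    -- (A2.2)
    (η : ℝ) (hη : 0 < η)
    (hA22 : ∀ c ∈ C, ∀ lam : Fin r → ℝ, (∀ i, 0 ≤ lam i) →
      (∀ i, ψ i c ≠ 0 → lam i = 0) → (∑ i, lam i) = 1 →
      2 * η < ‖∑ i, lam i • ψ' i c‖) :
    ∃ Γ > (0:ℝ), ∃ r₁ > (0:ℝ), 2 * r₁ ≤ ρ ∧
      (∀ γ ≥ Γ, ∀ x : EuclideanSpace ℝ (Fin n), psiG ψ γ x = 0 →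
        ∀ z : EuclideanSpace ℝ (Fin n), ‖z - x‖ < 2 * r₁ →
          2 * η < ‖gradPsiG ψ ψ' γ z‖) ∧
      (∀ γ ≥ Γ, ∀ x : EuclideanSpace ℝ (Fin n), psiG ψ γ x = 0 →
          2 * η < ‖gradPsiG ψ ψ' γ x‖) := by
  have hmem : ∀ c ∈ C, {y | ∃ c ∈ C, dist y c < ρ} ∈ nhds c := fun c hc =>
    Filter.mem_of_superset (ball_mem_nhds c hρ) fun y hy => ⟨c, hc, hy⟩
  suffices h : ∃ Γ > (0:ℝ), ∃ r₁ > (0:ℝ), 2 * r₁ ≤ ρ ∧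
      ∀ γ ≥ Γ, ∀ x : EuclideanSpace ℝ (Fin n), psiG ψ γ x = 0 →
        ∀ z : EuclideanSpace ℝ (Fin n), ‖z - x‖ < 2 * r₁ →
          2 * η < ‖gradPsiG ψ ψ' γ z‖ by
    obtain ⟨Γ, hΓ, r₁, hr₁, hle, h⟩ := h
    exact ⟨Γ, hΓ, r₁, hr₁, hle, h, fun γ hγ x hx => h γ hγ x hx x (by simpa using hr₁)⟩
  by_contra! hcon
  have hex (k : ℕ) : ∃ γ ≥ (k : ℝ) + 1, ∃ x, psiG ψ γ x = 0 ∧ ∃ z,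
      ‖z - x‖ < ρ * (1 / ((k : ℝ) + 1)) ∧ ‖gradPsiG ψ ψ' γ z‖ ≤ 2 * η := by
    have hk : 1 / ((k : ℝ) + 1) ≤ 1 := by
      rw [div_le_one (by positivity)]
      linarith [k.cast_nonneg (α := ℝ)]
    obtain ⟨γ, hγ, x, hx, z, hz, h⟩ := hcon (k + 1) (by positivity)
      (ρ * (1 / ((k : ℝ) + 1)) / 2) (by positivity)
      (by rw [mul_div_cancel₀ _ two_ne_zero]; exact mul_le_of_le_one_right hρ.le hk)
    exact ⟨γ, hγ, x, hx, z, by rwa [mul_div_cancel₀ _ two_ne_zero] at hz, h⟩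
  choose γ hγ x hx z hz hgrad using hex
  have hγpos (k : ℕ) : 0 < γ k := lt_of_lt_of_le (by positivity) (hγ k)
  have hxC (k : ℕ) : x k ∈ C := by
    rw [hCdef]
    exact mem_iInter.mpr fun i => nonpos_of_psiG_eq_zero hr (hγpos k) (hx k) i
  obtain ⟨⟨c, lam⟩, ⟨hc, hlam⟩, φ, hφ, hlim⟩ :=
    (hCcp.prod (isCompact_stdSimplex ℝ (Fin r))).tendsto_subseq
      (x := fun k => (x k, softmaxWeight ψ (γ k) (z k)))
      fun k => ⟨hxC k, softmaxWeight_mem_stdSimplex hr ψ (γ k) (z k)⟩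
  have hxc : Tendsto (x ∘ φ) atTop (𝓝 c) := (continuous_fst.tendsto _).comp hlim
  have hw (i : Fin r) : Tendsto (fun k => softmaxWeight ψ (γ (φ k)) (z (φ k)) i) atTop
      (𝓝 (lam i)) :=
    (((continuous_apply i).comp continuous_snd).tendsto (c, lam)).comp hlim
  have hγφ : Tendsto (γ ∘ φ) atTop atTop :=
    (tendsto_atTop_mono (fun k => (le_add_of_nonneg_right zero_le_one).trans (hγ k))
      tendsto_natCast_atTop_atTop).comp hφ.tendsto_atTop
  have hzx : Tendsto (fun k => z k - x k) atTop (𝓝 0) :=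
    squeeze_zero_norm (fun k => (hz k).le)
      (by simpa using tendsto_one_div_add_atTop_nhds_zero_nat.const_mul ρ)
  have hzc : Tendsto (z ∘ φ) atTop (𝓝 c) := by
    simpa [Function.comp_def] using (hzx.comp hφ.tendsto_atTop).add hxc
  have hcont (i : Fin r) : ContinuousAt (ψ i) c :=
    (hdiff i c (mem_of_mem_nhds (hmem c hc))).continuousAt
  have hcont' (i : Fin r) : ContinuousAt (ψ' i) c :=
    (hlip i).choose_spec.continuousOn.continuousAt (hmem c hc)
  have hnonpos (i : Fin r) : ψ i c ≤ 0 := by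
    rw [hCdef] at hc
    exact mem_iInter.mp hc i
  obtain ⟨j, hj⟩ := exists_active_of_tendsto hr hγφ (fun k => hγpos (φ k))
    (fun k => hx (φ k)) hxc hcont hnonpos
  have hinactive (i : Fin r) (hi : ψ i c ≠ 0) : lam i = 0 :=
    tendsto_nhds_unique (hw i) (tendsto_softmaxWeight_zero hγφ hzc hcont
      (hj ▸ lt_of_le_of_ne (hnonpos i) hi : ψ i c < ψ j c))
  have hgradlim : Tendsto (fun k => gradPsiG ψ ψ' (γ (φ k)) (z (φ k))) atTop
      (𝓝 (∑ i, lam i • ψ' i c)) := by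
    simp only [gradPsiG_eq_sum_softmaxWeight]
    exact tendsto_finsetSum _ fun i _ => (hw i).smul ((hcont' i).tendsto.comp hzc)
  exact absurd (hA22 c hc lam hlam.1 hinactive hlam.2)
    (le_of_tendsto' hgradlim.norm fun k => hgrad (φ k)).not_gt
end
end

section
/- Under (A2.1) and (A2.2), with C nonempty and compact, there exist Γ > 0 and ε_o > 0 such that for every γ ≥ Γ and every x ∈ C^γ with ‖∇ψ_γ(x)‖ ≤ η, one has ψ_γ(x) < −ε_o. -/
open Metric Set
open scoped BigOperators

noncomputable section

theorem exp_mul_psiG {n r : ℕ} (hr : 0 < r) (ψ : Fin r → EuclideanSpace ℝ (Fin n) → ℝ)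
    {γ : ℝ} (hγ : 0 < γ) (x : EuclideanSpace ℝ (Fin n)) :
    Real.exp (γ * psiG ψ γ x) = ∑ i, Real.exp (γ * ψ i x) := by
  have : Nonempty (Fin r) := ⟨⟨0, hr⟩⟩
  have hpos : 0 < ∑ i, Real.exp (γ * ψ i x) :=
    Finset.sum_pos (fun i _ => Real.exp_pos _) Finset.univ_nonempty
  rw [psiG, ← mul_assoc, mul_one_div_cancel hγ.ne', one_mul, Real.exp_log hpos]

theorem le_psiG {n r : ℕ} (hr : 0 < r) (ψ : Fin r → EuclideanSpace ℝ (Fin n) → ℝ)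
    {γ : ℝ} (hγ : 0 < γ) (x : EuclideanSpace ℝ (Fin n)) (i : Fin r) :
    ψ i x ≤ psiG ψ γ x := by
  have h : Real.exp (γ * ψ i x) ≤ Real.exp (γ * psiG ψ γ x) := by
    rw [exp_mul_psiG hr ψ hγ]
    exact Finset.single_le_sum (f := fun i => Real.exp (γ * ψ i x))
      (fun j _ => (Real.exp_pos _).le) (Finset.mem_univ i)
  exact le_of_mul_le_mul_left (Real.exp_le_exp.1 h) hγ

/-- The weights of the convex combination of gradients defining `gradPsiG`. -/
def psiGWeight {n r : ℕ} (ψ : Fin r → EuclideanSpace ℝ (Fin n) → ℝ) (γ : ℝ)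
    (x : EuclideanSpace ℝ (Fin n)) (i : Fin r) : ℝ :=
  Real.exp (γ * (ψ i x - psiG ψ γ x))

theorem psiGWeight_eq {n r : ℕ} (hr : 0 < r) (ψ : Fin r → EuclideanSpace ℝ (Fin n) → ℝ)
    {γ : ℝ} (hγ : 0 < γ) (x : EuclideanSpace ℝ (Fin n)) (i : Fin r) :
    psiGWeight ψ γ x i = (∑ j, Real.exp (γ * ψ j x))⁻¹ * Real.exp (γ * ψ i x) := by
  rw [psiGWeight, mul_sub, Real.exp_sub, exp_mul_psiG hr ψ hγ, div_eq_inv_mul]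

theorem psiGWeight_mem_stdSimplex {n r : ℕ} (hr : 0 < r)
    (ψ : Fin r → EuclideanSpace ℝ (Fin n) → ℝ) {γ : ℝ} (hγ : 0 < γ)
    (x : EuclideanSpace ℝ (Fin n)) : psiGWeight ψ γ x ∈ stdSimplex ℝ (Fin r) := by
  refine ⟨fun i => (Real.exp_pos _).le, ?_⟩
  simp_rw [psiGWeight_eq hr ψ hγ x]
  rw [← Finset.mul_sum, ← exp_mul_psiG hr ψ hγ, inv_mul_cancel₀ (Real.exp_pos _).ne']

theorem gradPsiG_eq_sum {n r : ℕ} (hr : 0 < r) (ψ : Fin r → EuclideanSpace ℝ (Fin n) → ℝ)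
    (ψ' : Fin r → EuclideanSpace ℝ (Fin n) → EuclideanSpace ℝ (Fin n))
    {γ : ℝ} (hγ : 0 < γ) (x : EuclideanSpace ℝ (Fin n)) :
    gradPsiG ψ ψ' γ x = ∑ i, psiGWeight ψ γ x i • ψ' i x := by
  simp_rw [psiGWeight_eq hr ψ hγ x, gradPsiG, Finset.smul_sum, smul_smul]

theorem stmt_3 {n r : ℕ} (hn : 0 < n) (hr : 0 < r)
    (ψ : Fin r → EuclideanSpace ℝ (Fin n) → ℝ)
    (ψ' : Fin r → EuclideanSpace ℝ (Fin n) → EuclideanSpace ℝ (Fin n))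
    (C : Set (EuclideanSpace ℝ (Fin n)))
    (hCdef : C = ⋂ i, {x | ψ i x ≤ 0})
    (hCne : C.Nonempty) (hCcp : IsCompact C)
    -- (A2.1)
    (ρ : ℝ) (hρ : 0 < ρ)
    (hdiff : ∀ i, ∀ x ∈ {y | ∃ c ∈ C, dist y c < ρ}, HasGradientAt (ψ i) (ψ' i x) x)
    (hlip : ∀ i, ∃ L : NNReal, LipschitzOnWith L (ψ' i) {y | ∃ c ∈ C, dist y c < ρ})
    -- (A2.2)
    (η : ℝ) (hη : 0 < η)
    (hA22 : ∀ c ∈ C, ∀ lam : Fin r → ℝ, (∀ i, 0 ≤ lam i) →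
      (∀ i, ψ i c ≠ 0 → lam i = 0) → (∑ i, lam i) = 1 →
      2 * η < ‖∑ i, lam i • ψ' i c‖) :
    ∃ Γ > (0:ℝ), ∃ εo > (0:ℝ), ∀ γ ≥ Γ, ∀ x : EuclideanSpace ℝ (Fin n),
      psiG ψ γ x ≤ 0 → ‖gradPsiG ψ ψ' γ x‖ ≤ η → psiG ψ γ x < -εo := by
  by_contra! hcon
  have hk : ∀ k : ℕ, (0 : ℝ) < k + 1 := fun k => by positivity
  have hk' : ∀ k : ℕ, (0 : ℝ) < 1 / ((k : ℝ) + 1) := fun k => by positivity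
  choose γ hγ x hx0 hxη hxε using fun k : ℕ => hcon (k + 1) (hk k) (1 / ((k : ℝ) + 1)) (hk' k)
  have hγ0 : ∀ k, 0 < γ k := fun k => (hk k).trans_le (hγ k)
  have hxC : ∀ k, x k ∈ C := fun k => by
    rw [hCdef]
    exact mem_iInter.2 fun i => (le_psiG hr ψ (hγ0 k) (x k) i).trans (hx0 k)
  obtain ⟨⟨c, l⟩, ⟨hc, hl⟩, φ, hφ, hlim⟩ :=
    (hCcp.prod (isCompact_stdSimplex ℝ (Fin r))).tendsto_subseq
      (x := fun k => (x k, psiGWeight ψ (γ k) (x k)))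
      fun k => ⟨hxC k, psiGWeight_mem_stdSimplex hr ψ (hγ0 k) (x k)⟩
  have hlimx : Filter.Tendsto (fun k => x (φ k)) Filter.atTop (nhds c) :=
    (continuous_fst.tendsto _).comp hlim
  have hliml : ∀ i, Filter.Tendsto (fun k => psiGWeight ψ (γ (φ k)) (x (φ k)) i)
      Filter.atTop (nhds (l i)) := fun i =>
    ((continuous_apply i).tendsto _).comp ((continuous_snd.tendsto _).comp hlim)
  have hsub : C ⊆ {y | ∃ c ∈ C, dist y c < ρ} := fun y hy => ⟨y, hy, by simpa using hρ⟩
  have hlimψ : ∀ i, Filter.Tendsto (fun k => ψ i (x (φ k))) Filter.atTop (nhds (ψ i c)) :=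
    fun i => (hdiff i c (hsub hc)).continuousAt.tendsto.comp hlimx
  have hlimψ' : ∀ i, Filter.Tendsto (fun k => ψ' i (x (φ k))) Filter.atTop (nhds (ψ' i c)) := by
    intro i
    obtain ⟨L, hL⟩ := hlip i
    exact (hL.continuousOn c (hsub hc)).tendsto.comp
      (tendsto_nhdsWithin_iff.2 ⟨hlimx, .of_forall fun k => hsub (hxC _)⟩)
  have hγlim : Filter.Tendsto (fun k => γ (φ k)) Filter.atTop Filter.atTop :=
    (Filter.tendsto_atTop_mono (fun k => (le_add_of_nonneg_right zero_le_one).trans (hγ k))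
      tendsto_natCast_atTop_atTop).comp hφ.tendsto_atTop
  have hεlim : Filter.Tendsto (fun k => 1 / ((φ k : ℝ) + 1)) Filter.atTop (nhds 0) :=
    tendsto_one_div_add_atTop_nhds_zero_nat.comp hφ.tendsto_atTop
  have hinactive : ∀ i, ψ i c ≠ 0 → l i = 0 := by
    intro i hi
    have hlt : ψ i c + 0 < 0 := by
      rw [hCdef] at hc
      simpa using lt_of_le_of_ne (mem_iInter.1 hc i) hi
    refine tendsto_nhds_unique (hliml i) (squeeze_zero (fun k => (Real.exp_pos _).le) (fun k => ?_)
      (Real.tendsto_exp_atBot.comp (hγlim.atTop_mul_neg hlt ((hlimψ i).add hεlim))))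
    refine Real.exp_le_exp.2 (mul_le_mul_of_nonneg_left ?_ (hγ0 _).le)
    linarith [hxε (φ k)]
  refine absurd (hA22 c hc l hl.1 hinactive hl.2) (not_lt.2 ?_)
  have hle : ‖∑ i, l i • ψ' i c‖ ≤ η := by
    refine le_of_tendsto (tendsto_finsetSum _ fun i _ => (hliml i).smul (hlimψ' i)).norm
      (.of_forall fun k => ?_)
    rw [← gradPsiG_eq_sum hr ψ ψ' (hγ0 _)]
    exact hxη (φ k)
  linarith
end
end

section
/- Under (A2.1) and (A2.2), with C nonempty and compact, and with M̄ > 0 fixed, let (γ_k)_{k∈ℕ} be a strictly increasing sequence with γ_k ≥ 2eM̄/η for all k and γ_k → ∞, and set C^{γ_k}(k) := {x : ψ_{γ_k}(x) ≤ −α_{γ_k}}. Then the sequence of sets (C^{γ_k}(k))_k is nondecreasing (C^{γ_k}(k) ⊆ C^{γ_{k+1}}(k+1) for all k); the interior of C equals ⋃_{k∈ℕ} int C^{γ_k}(k) and also equals ⋃_{k∈ℕ} C^{γ_k}(k); and the closure of ⋃_{k∈ℕ} C^{γ_k}(k) equals C. -/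
open Metric Set Filter
open scoped BigOperators

noncomputable section

/-- The level `α_γ := ln(ηγ/(2M̄))/γ`. -/
def alph (η Mb γ : ℝ) : ℝ := Real.log (η * γ / (2 * Mb)) / γ

/-- The sublevel condition `ψ_γ ≤ -α_γ` in exponential form. -/
lemma psiG_le_neg_alph_iff {n r : ℕ} (hr : 0 < r)
    (ψ : Fin r → EuclideanSpace ℝ (Fin n) → ℝ) {η Mb γ : ℝ} (hη : 0 < η) (hMb : 0 < Mb)
    (hγ : 0 < γ) (x : EuclideanSpace ℝ (Fin n)) :
    psiG ψ γ x ≤ -(alph η Mb γ) ↔ ∑ i, γ * Real.exp (γ * ψ i x) ≤ 2 * Mb / η := by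
  have : Nonempty (Fin r) := ⟨⟨0, hr⟩⟩
  have hS : 0 < ∑ i, Real.exp (γ * ψ i x) :=
    Finset.sum_pos (fun i _ => Real.exp_pos _) Finset.univ_nonempty
  have h1 : -(alph η Mb γ) = (1 / γ) * Real.log (2 * Mb / (η * γ)) := by
    rw [alph, ← inv_div (η * γ) (2 * Mb), Real.log_inv]
    ring
  rw [h1, psiG, mul_le_mul_iff_right₀ (by positivity),
    Real.log_le_log_iff hS (by positivity), ← Finset.mul_sum, le_div_iff₀ (by positivity),
    le_div_iff₀ hη]
  constructor <;> intro h <;> linarith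

/-- `t ↦ t * exp (t * p)` decreases beyond `s` once `s * p ≤ -1`. -/
lemma mul_exp_mul_le_of_mul_le_neg_one {s t p : ℝ} (hs : 0 < s) (hst : s ≤ t)
    (hp : s * p ≤ -1) : t * Real.exp (t * p) ≤ s * Real.exp (s * p) := by
  have h1 : t / s ≤ Real.exp (t / s - 1) := by
    linarith [Real.add_one_le_exp (t / s - 1)]
  have h2 : t / s - 1 ≤ s * p - t * p := by
    have h3 : 0 ≤ t / s - 1 := by
      rw [sub_nonneg, le_div_iff₀ hs]
      linarith
    have h4 : s * p - t * p = (t / s - 1) * -(s * p) := by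
      field_simp
      ring
    rw [h4]
    nlinarith
  have h5 : t / s ≤ Real.exp (s * p - t * p) := h1.trans (Real.exp_le_exp.2 h2)
  rw [Real.exp_sub, div_le_div_iff₀ hs (Real.exp_pos _)] at h5
  linarith

/-- If no convex combination of the vectors `g i` with `i ∈ A` vanishes, then some direction has
negative inner product with all of them. -/
lemma exists_inner_neg_of_convex_combination_ne_zero {E : Type*} [NormedAddCommGroup E]
    [InnerProductSpace ℝ E] [CompleteSpace E] {ι : Type*} [Fintype ι] (g : ι → E) (A : Set ι)
    (h : ∀ lam : ι → ℝ, (∀ i, 0 ≤ lam i) → (∀ i, i ∉ A → lam i = 0) → ∑ i, lam i = 1 →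
      ∑ i, lam i • g i ≠ 0) :
    ∃ d : E, ∀ i ∈ A, inner ℝ (g i) d < 0 := by
  classical
  let L : (ι → ℝ) →ₗ[ℝ] E := Fintype.linearCombination ℝ g
  have hLc : Continuous L := by
    have : (L : (ι → ℝ) → E) = fun lam => ∑ i, lam i • g i := by
      ext lam
      simp [L, Fintype.linearCombination_apply]
    rw [this]
    fun_prop
  let Z : Set (ι → ℝ) := {lam | ∀ i, i ∉ A → lam i = 0}
  have hZc : IsClosed Z := by
    have : Z = ⋂ i, ⋂ (_ : i ∉ A), {lam | lam i = 0} := by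
      ext
      simp [Z]
    rw [this]
    exact isClosed_iInter fun i => isClosed_iInter fun _ =>
      isClosed_eq (continuous_apply i) continuous_const
  have hZv : Convex ℝ Z := by
    intro x hx y hy a b _ _ _ i hi
    simp [hx i hi, hy i hi]
  have hK : IsCompact (L '' (stdSimplex ℝ ι ∩ Z)) :=
    ((isCompact_stdSimplex ℝ ι).inter_right hZc).image hLc
  have hKv : Convex ℝ (L '' (stdSimplex ℝ ι ∩ Z)) :=
    ((convex_stdSimplex ℝ ι).inter hZv).linear_image L
  have h0 : (0 : E) ∉ L '' (stdSimplex ℝ ι ∩ Z) := by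
    rintro ⟨lam, ⟨⟨hpos, hsum⟩, hz⟩, hl⟩
    exact h lam hpos hz hsum (by simpa [L, Fintype.linearCombination_apply] using hl)
  obtain ⟨f, u, hf0, hf⟩ := geometric_hahn_banach_point_closed hKv hK.isClosed h0
  refine ⟨-(InnerProductSpace.toDual ℝ E).symm f, fun i hi => ?_⟩
  have hmem : g i ∈ L '' (stdSimplex ℝ ι ∩ Z) := by
    refine ⟨Pi.single i 1, ⟨single_mem_stdSimplex ℝ i, fun j hj => ?_⟩, ?_⟩
    · exact Pi.single_eq_of_ne (fun e : j = i => hj (e ▸ hi)) _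
    · simp [L]
  have h1 := hf _ hmem
  rw [map_zero] at hf0
  rw [inner_neg_right, real_inner_comm, InnerProductSpace.toDual_symm_apply]
  linarith

/-- A function with negative slope along `d` at a zero is negative just after it. -/
lemma eventually_neg_of_hasGradientAt {E : Type*} [NormedAddCommGroup E]
    [InnerProductSpace ℝ E] [CompleteSpace E] {f : E → ℝ} {g c d : E}
    (hf : HasGradientAt f g c) (hc : f c = 0) (hd : inner ℝ g d < 0) :
    ∀ᶠ t : ℝ in nhdsWithin 0 (Ioi 0), f (c + t • d) < 0 := by
  have hline : HasDerivAt (fun t : ℝ => c + t • d) d 0 := by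
    simpa using ((hasDerivAt_id (0 : ℝ)).smul_const d).const_add c
  have h1 : HasDerivAt (fun t : ℝ => f (c + t • d)) (inner ℝ g d) 0 := by
    have h2 : HasFDerivAt f (InnerProductSpace.toDual ℝ E g) (c + (0 : ℝ) • d) := by
      simpa using hf.hasFDerivAt
    have h3 := h2.comp_hasDerivAt (0 : ℝ) hline
    rw [InnerProductSpace.toDual_apply_apply] at h3
    exact h3
  have h3 := (hasDerivAt_iff_tendsto_slope.1 h1).eventually_lt_const hd
  have h4 := h3.filter_mono (nhdsWithin_mono (0 : ℝ)
    (fun t (ht : 0 < t) => (ht.ne' : t ∈ ({0}ᶜ : Set ℝ))))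
  filter_upwards [h4, self_mem_nhdsWithin] with t ht ht0
  have ht0 : 0 < t := ht0
  rw [slope_def_field] at ht
  simp only [zero_smul, add_zero, hc, sub_zero] at ht
  by_contra hcon
  exact absurd (div_nonneg (not_lt.1 hcon) ht0.le) (not_le.2 ht)

theorem stmt_5 {n r : ℕ} (hn : 0 < n) (hr : 0 < r)
    (ψ : Fin r → EuclideanSpace ℝ (Fin n) → ℝ)
    (ψ' : Fin r → EuclideanSpace ℝ (Fin n) → EuclideanSpace ℝ (Fin n))
    (C : Set (EuclideanSpace ℝ (Fin n)))
    (hCdef : C = ⋂ i, {x | ψ i x ≤ 0})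
    (hCne : C.Nonempty) (hCcp : IsCompact C)
    -- (A2.1)
    (ρ : ℝ) (hρ : 0 < ρ)
    (hdiff : ∀ i, ∀ x ∈ {y | ∃ c ∈ C, dist y c < ρ}, HasGradientAt (ψ i) (ψ' i x) x)
    (hlip : ∀ i, ∃ L : NNReal, LipschitzOnWith L (ψ' i) {y | ∃ c ∈ C, dist y c < ρ})
    -- (A2.2)
    (η : ℝ) (hη : 0 < η)
    (hA22 : ∀ c ∈ C, ∀ lam : Fin r → ℝ, (∀ i, 0 ≤ lam i) →
      (∀ i, ψ i c ≠ 0 → lam i = 0) → (∑ i, lam i) = 1 →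
      2 * η < ‖∑ i, lam i • ψ' i c‖)
    (Mb : ℝ) (hMb : 0 < Mb)
    -- the sequence (γ_k)_k
    (γ : ℕ → ℝ) (hmono : StrictMono γ)
    (hγlb : ∀ k, 2 * Real.exp 1 * Mb / η ≤ γ k)
    (hγtop : Tendsto γ atTop atTop) :
    (∀ k : ℕ,
      {x : EuclideanSpace ℝ (Fin n) | psiG ψ (γ k) x ≤ -(alph η Mb (γ k))} ⊆
      {x : EuclideanSpace ℝ (Fin n) | psiG ψ (γ (k+1)) x ≤ -(alph η Mb (γ (k+1)))}) ∧
    interior C =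
      (⋃ k : ℕ, interior {x : EuclideanSpace ℝ (Fin n) | psiG ψ (γ k) x ≤ -(alph η Mb (γ k))}) ∧
    interior C =
      (⋃ k : ℕ, {x : EuclideanSpace ℝ (Fin n) | psiG ψ (γ k) x ≤ -(alph η Mb (γ k))}) ∧
    closure (⋃ k : ℕ, {x : EuclideanSpace ℝ (Fin n) | psiG ψ (γ k) x ≤ -(alph η Mb (γ k))}) = C := by
  set S : ℕ → Set (EuclideanSpace ℝ (Fin n)) :=
    fun k => {x | psiG ψ (γ k) x ≤ -(alph η Mb (γ k))} with hS
  set D : Set (EuclideanSpace ℝ (Fin n)) := {x | ∀ i, ψ i x < 0} with hD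
  have hCmem : ∀ x, x ∈ C ↔ ∀ i, ψ i x ≤ 0 := by
    intro x
    simp [hCdef]
  have hγpos : ∀ k, 0 < γ k := fun k => lt_of_lt_of_le (by positivity) (hγlb k)
  have hSmem : ∀ k x, x ∈ S k ↔ ∑ i, γ k * Real.exp (γ k * ψ i x) ≤ 2 * Mb / η :=
    fun k x => psiG_le_neg_alph_iff hr ψ hη hMb (hγpos k) x
  have hSle : ∀ k, ∀ x ∈ S k, ∀ i, γ k * ψ i x ≤ -1 := by
    intro k x hx i
    have h1 : γ k * Real.exp (γ k * ψ i x) ≤ 2 * Mb / η :=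
      (Finset.single_le_sum (f := fun i => γ k * Real.exp (γ k * ψ i x))
        (fun j _ => mul_nonneg (hγpos k).le (Real.exp_pos _).le)
        (Finset.mem_univ i)).trans ((hSmem k x).1 hx)
    have h2 : Real.exp 1 * (2 * Mb / η) ≤ γ k := by
      calc _ = 2 * Real.exp 1 * Mb / η := by ring
        _ ≤ γ k := hγlb k
    have h3 : γ k * Real.exp (γ k * ψ i x + 1) ≤ γ k * 1 := by
      rw [Real.exp_add]
      nlinarith [Real.exp_pos 1]
    have h4 := Real.exp_le_one_iff.1 (le_of_mul_le_mul_left h3 (hγpos k))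
    linarith
  have hSD : ∀ k, S k ⊆ D := by
    intro k x hx i
    by_contra hcon
    nlinarith [hSle k x hx i, mul_nonneg (hγpos k).le (not_lt.1 hcon)]
  have hDC : D ⊆ C := fun x hx => (hCmem x).2 fun i => (hx i).le
  have hgrad : ∀ i, ∀ x ∈ C, HasGradientAt (ψ i) (ψ' i x) x :=
    fun i x hx => hdiff i x ⟨x, hx, by simpa using hρ⟩
  have hcont : ∀ i, ∀ x ∈ C, ContinuousAt (ψ i) x :=
    fun i x hx => (hgrad i x hx).continuousAt
  have hDS : D ⊆ ⋃ k, interior (S k) := by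
    intro x hx
    have : Nonempty (Fin r) := ⟨⟨0, hr⟩⟩
    obtain ⟨j, hj⟩ := Finite.exists_max fun i => ψ i x
    set δ : ℝ := -(ψ j x) / 2 with hδ
    have hδpos : 0 < δ := by
      have := hx j
      rw [hδ]
      linarith
    have hnear : ∀ᶠ y in nhds x, ∀ i, ψ i y < -δ := by
      refine eventually_all.2 fun i => (hcont i x (hDC hx)).eventually_lt_const ?_
      have h1 := hj i
      linarith
    have hlim : Tendsto (fun t : ℝ => (r : ℝ) * (t * Real.exp (-δ * t))) atTop (nhds 0) := by
      have h1 := tendsto_rpow_mul_exp_neg_mul_atTop_nhds_zero 1 δ hδpos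
      simpa using h1.const_mul (r : ℝ)
    have hpos : 0 < 2 * Mb / η := by positivity
    obtain ⟨k, hk⟩ := ((hlim.comp hγtop).eventually_lt_const hpos).exists
    refine mem_iUnion.2 ⟨k, mem_interior_iff_mem_nhds.2 ?_⟩
    filter_upwards [hnear] with y hy
    refine (hSmem k y).2 (le_trans ?_ (le_of_lt hk))
    have h2 : ∑ i : Fin r, γ k * Real.exp (γ k * ψ i y)
        ≤ ∑ _i : Fin r, γ k * Real.exp (-δ * γ k) := by
      refine Finset.sum_le_sum fun i _ => ?_
      refine mul_le_mul_of_nonneg_left (Real.exp_le_exp.2 ?_) (hγpos k).le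
      nlinarith [hy i, hγpos k]
    simpa using h2
  have hUS : (⋃ k, S k) = D := by
    refine Subset.antisymm (iUnion_subset hSD) (hDS.trans ?_)
    exact iUnion_mono fun k => interior_subset
  have hUI : (⋃ k, interior (S k)) = D :=
    Subset.antisymm (iUnion_subset fun k => interior_subset.trans (hSD k)) hDS
  have hint : interior C = D := by
    refine Subset.antisymm (fun x hx i => ?_) ?_
    · have hxC := interior_subset hx
      refine lt_of_le_of_ne ((hCmem x).1 hxC i) fun h0 => ?_
      have hmax : IsLocalMax (ψ i) x := by
        filter_upwards [mem_interior_iff_mem_nhds.1 hx] with y hy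
        rw [h0]
        exact (hCmem y).1 hy i
      have hz : ψ' i x = 0 := by
        have h1 := hmax.hasFDerivAt_eq_zero (hgrad i x hxC).hasFDerivAt
        simpa using h1
      have h2 := hA22 x hxC (Pi.single i 1)
        (fun j => by
          by_cases h : j = i
          · subst h; simp
          · simp [h])
        (fun j hj => Pi.single_eq_of_ne (fun e : j = i => hj (e ▸ h0)) _)
        (by simp)
      have h3 : ∑ j, (Pi.single i 1 : Fin r → ℝ) j • ψ' j x = 0 := by
        refine Finset.sum_eq_zero fun j _ => ?_
        by_cases h : j = i
        · subst h; simp [hz]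
        · simp [h]
      rw [h3, norm_zero] at h2
      linarith
    · rw [← hUI]
      exact iUnion_subset fun k => interior_mono ((hSD k).trans hDC)
  refine ⟨fun k x hx => ?_, hint.trans hUI.symm, hint.trans hUS.symm, ?_⟩
  · refine (hSmem (k + 1) x).2 (le_trans ?_ ((hSmem k x).1 hx))
    exact Finset.sum_le_sum fun i _ => mul_exp_mul_le_of_mul_le_neg_one (hγpos k)
      (hmono (Nat.lt_succ_self k)).le (hSle k x hx i)
  · rw [hUS]
    refine Subset.antisymm (closure_minimal hDC hCcp.isClosed) fun c hc => ?_
    obtain ⟨d, hd⟩ := exists_inner_neg_of_convex_combination_ne_zero (fun i => ψ' i c)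
      {i | ψ i c = 0} fun lam hpos hz hsum h0 => by
        have h1 := hA22 c hc lam hpos hz hsum
        rw [h0, norm_zero] at h1
        linarith
    have htend : Tendsto (fun t : ℝ => c + t • d) (nhdsWithin 0 (Ioi 0)) (nhds c) := by
      have h1 : Continuous fun t : ℝ => c + t • d := by fun_prop
      simpa using (h1.tendsto 0).mono_left nhdsWithin_le_nhds
    refine mem_closure_of_tendsto htend (eventually_all.2 fun i => ?_)
    rcases ((hCmem c).1 hc i).lt_or_eq with hlt | heq
    · exact htend.eventually ((hcont i c hc).eventually_lt_const hlt)
    · exact eventually_neg_of_hasGradientAt (hgrad i c hc) heq (hd i heq)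
end
end

section
/- Under (A2.1) and (A2.2), with C nonempty and compact, and with M̄ > 0 fixed, let (γ_k)_{k∈ℕ} be a sequence with γ_k > 2M̄/η for all k and γ_k → ∞, and set σ_k := (r M̄_ψ/(2η²)) (ln(r)/γ_k + α_{γ_k}) and C^{γ_k}(k) := {x : ψ_{γ_k}(x) ≤ −α_{γ_k}}. Then for every c in the topological boundary of C there exist k̄ ∈ ℕ, r_c > 0, and a nonzero vector d_c ∈ ℝⁿ such that for all k ≥ k̄: (C ∩ B̄_{r_c}(c)) + σ_k · d_c/‖d_c‖ ⊆ int C^{γ_k}(k), where B̄_{r_c}(c) is the closed ball of radius r_c centered at c. In particular, c + σ_k d_c/‖d_c‖ ∈ int C^{γ_k}(k) for all k ≥ k̄. -/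
open Metric Set Filter
open scoped BigOperators RealInnerProductSpace

noncomputable section

/-- A finite family of vectors all of whose convex combinations (supported on `{i | p i}`) have
norm greater than `m` admits a unit direction making inner product less than `-m` with each
member of the family. -/
lemma exists_unit_inner_lt_of_convexComb_norm_gt {ι E : Type*} [Fintype ι] [NormedAddCommGroup E]
    [InnerProductSpace ℝ E] (g : ι → E) (p : ι → Prop) {m : ℝ} (hm : 0 ≤ m)
    (hne : ∃ i, p i)
    (h : ∀ lam : ι → ℝ, (∀ i, 0 ≤ lam i) → (∀ i, ¬ p i → lam i = 0) → ∑ i, lam i = 1 →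
      m < ‖∑ i, lam i • g i‖) :
    ∃ u : E, ‖u‖ = 1 ∧ ∀ i, p i → ⟪g i, u⟫ < -m := by
  classical
  set S : Set (ι → ℝ) := stdSimplex ℝ ι ∩ {lam | ∀ i, ¬ p i → lam i = 0} with hS
  have hScp : IsCompact S := by
    refine (isCompact_stdSimplex ℝ ι).inter_right ?_
    simp only [ofPred_forall]
    exact isClosed_iInter fun i => isClosed_iInter fun _ =>
      isClosed_eq (continuous_apply i) continuous_const
  have hScv : Convex ℝ S := by
    refine (convex_stdSimplex ℝ ι).inter ?_
    intro a ha b hb s t _ _ _ i hi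
    simp [ha i hi, hb i hi]
  let L : (ι → ℝ) →ₗ[ℝ] E := Fintype.linearCombination ℝ g
  have hL : ∀ lam, L lam = ∑ i, lam i • g i := fun lam => Fintype.linearCombination_apply ℝ g lam
  have hLc : Continuous L := by
    have : (L : (ι → ℝ) → E) = fun lam => ∑ i, lam i • g i := funext hL
    rw [this]
    fun_prop
  have hsingle : ∀ i, p i → Pi.single i 1 ∈ S := by
    intro i hi
    refine ⟨single_mem_stdSimplex ℝ i, fun j hj => ?_⟩
    have : j ≠ i := fun e => hj (e ▸ hi)
    simp [this]
  have hmem : ∀ i, p i → g i ∈ L '' S := by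
    intro i hi
    refine ⟨Pi.single i 1, hsingle i hi, ?_⟩
    simp [L]
  obtain ⟨i₀, hi₀⟩ := hne
  obtain ⟨v, hv, hvmin⟩ := exists_norm_eq_iInf_of_complete_convex ⟨_, hmem i₀ hi₀⟩
    (hScp.image hLc).isComplete (hScv.linear_image L) 0
  have hinner := (norm_eq_iInf_iff_real_inner_le_zero (hScv.linear_image L) hv).1 hvmin
  have hvm : m < ‖v‖ := by
    obtain ⟨lam, hlam, rfl⟩ := hv
    rw [hL]
    exact h lam hlam.1.1 hlam.2 hlam.1.2
  have hv0 : 0 < ‖v‖ := hm.trans_lt hvm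
  refine ⟨-(‖v‖⁻¹ • v), ?_, fun i hi => ?_⟩
  · rw [norm_neg, norm_smul, norm_inv, norm_norm, inv_mul_cancel₀ hv0.ne']
  · have h1 := hinner (g i) (hmem i hi)
    rw [zero_sub, inner_neg_left, inner_sub_right, real_inner_self_eq_norm_sq,
      real_inner_comm] at h1
    rw [inner_neg_right, inner_smul_right, neg_lt_neg_iff]
    calc m < ‖v‖ := hvm
      _ = ‖v‖⁻¹ * ‖v‖ ^ 2 := by field_simp
      _ ≤ ‖v‖⁻¹ * ⟪g i, v⟫ := by gcongr; linarith

lemma psiG_le_add_log_div {n r : ℕ} (hr : 0 < r)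
    (ψ : Fin r → EuclideanSpace ℝ (Fin n) → ℝ) {γ m : ℝ} (hγ : 0 < γ)
    {y : EuclideanSpace ℝ (Fin n)} (h : ∀ i, ψ i y ≤ m) :
    psiG ψ γ y ≤ m + Real.log r / γ := by
  have : Nonempty (Fin r) := ⟨⟨0, hr⟩⟩
  have hr' : (0 : ℝ) < r := by exact_mod_cast hr
  have hsum : ∑ i, Real.exp (γ * ψ i y) ≤ r * Real.exp (γ * m) := by
    calc ∑ i, Real.exp (γ * ψ i y) ≤ ∑ _i : Fin r, Real.exp (γ * m) := by
          gcongr with i; exact h i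
      _ = r * Real.exp (γ * m) := by simp
  have hpos : 0 < ∑ i, Real.exp (γ * ψ i y) :=
    Finset.sum_pos (fun i _ => Real.exp_pos _) Finset.univ_nonempty
  have hlog := Real.log_le_log hpos hsum
  rw [Real.log_mul hr'.ne' (Real.exp_ne_zero _), Real.log_exp] at hlog
  unfold psiG
  calc 1 / γ * Real.log (∑ i, Real.exp (γ * ψ i y))
      ≤ 1 / γ * (Real.log r + γ * m) := by gcongr
    _ = m + Real.log r / γ := by field_simp; ring

lemma continuousAt_psiG {n r : ℕ} (hr : 0 < r)
    {ψ : Fin r → EuclideanSpace ℝ (Fin n) → ℝ} (γ : ℝ) {y : EuclideanSpace ℝ (Fin n)}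
    (h : ∀ i, ContinuousAt (ψ i) y) : ContinuousAt (psiG ψ γ) y := by
  have : Nonempty (Fin r) := ⟨⟨0, hr⟩⟩
  have hpos : 0 < ∑ i, Real.exp (γ * ψ i y) :=
    Finset.sum_pos (fun i _ => Real.exp_pos _) Finset.univ_nonempty
  have hsum : ContinuousAt (fun x => ∑ i, Real.exp (γ * ψ i x)) y :=
    tendsto_finsetSum _ fun i _ => ((h i).const_mul γ).rexp
  exact (hsum.log hpos.ne').const_mul (1 / γ)

lemma alph_pos {η Mb γ : ℝ} (hη : 0 < η) (hMb : 0 < Mb) (hγ : 2 * Mb / η < γ) :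
    0 < alph η Mb γ := by
  have hγ0 : 0 < γ := lt_trans (by positivity) hγ
  refine div_pos (Real.log_pos ?_) hγ0
  rw [div_lt_iff₀ hη] at hγ
  rw [lt_div_iff₀ (by positivity)]
  linarith

lemma tendsto_alph_atTop {η Mb : ℝ} (hη : 0 < η) (hMb : 0 < Mb) :
    Tendsto (alph η Mb) atTop (nhds 0) := by
  have h1 : Tendsto (fun x : ℝ => Real.log x / x) atTop (nhds 0) := by
    simpa using Real.tendsto_pow_log_div_mul_add_atTop 1 0 1 one_ne_zero
  have ha : 0 < η / (2 * Mb) := by positivity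
  have h2 := (h1.comp (tendsto_id.const_mul_atTop ha)).const_mul (η / (2 * Mb))
  rw [mul_zero] at h2
  refine h2.congr fun γ => ?_
  simp only [Function.comp, id, alph]
  rw [div_mul_eq_mul_div η]
  by_cases hγ : γ = 0
  · simp [hγ]
  · field_simp

theorem stmt_6 {n r : ℕ} (hn : 0 < n) (hr : 0 < r)
    (ψ : Fin r → EuclideanSpace ℝ (Fin n) → ℝ)
    (ψ' : Fin r → EuclideanSpace ℝ (Fin n) → EuclideanSpace ℝ (Fin n))
    (C : Set (EuclideanSpace ℝ (Fin n)))
    (hCdef : C = ⋂ i, {x | ψ i x ≤ 0})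
    (hCne : C.Nonempty) (hCcp : IsCompact C)
    -- (A2.1)
    (ρ : ℝ) (hρ : 0 < ρ)
    (hdiff : ∀ i, ∀ x ∈ {y | ∃ c ∈ C, dist y c < ρ}, HasGradientAt (ψ i) (ψ' i x) x)
    (hlip : ∀ i, ∃ L : NNReal, LipschitzOnWith L (ψ' i) {y | ∃ c ∈ C, dist y c < ρ})
    -- (A2.2)
    (η : ℝ) (hη : 0 < η)
    (hA22 : ∀ c ∈ C, ∀ lam : Fin r → ℝ, (∀ i, 0 ≤ lam i) →
      (∀ i, ψ i c ≠ 0 → lam i = 0) → (∑ i, lam i) = 1 →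
      2 * η < ‖∑ i, lam i • ψ' i c‖)
    -- bound on the gradients
    (Mψ : ℝ) (hMψη : 2 * η ≤ Mψ) (hMψ : ∀ i, ∀ x ∈ C, ‖ψ' i x‖ ≤ Mψ)
    (Mb : ℝ) (hMb : 0 < Mb)
    -- the sequence (γ_k)_k
    (γ : ℕ → ℝ) (hγlb : ∀ k, 2 * Mb / η < γ k) (hγtop : Tendsto γ atTop atTop)
    -- σ_k
    (σ : ℕ → ℝ)
    (hσ : ∀ k, σ k = (r * Mψ / (2 * η ^ 2)) * (Real.log r / γ k + alph η Mb (γ k))) :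
    ∀ c ∈ frontier C, ∃ kb : ℕ, ∃ rc > (0:ℝ), ∃ d : EuclideanSpace ℝ (Fin n), d ≠ 0 ∧
      (∀ k ≥ kb, ∀ x ∈ C ∩ closedBall c rc,
        x + σ k • (‖d‖⁻¹ • d) ∈
          interior {y : EuclideanSpace ℝ (Fin n) | psiG ψ (γ k) y ≤ -(alph η Mb (γ k))}) ∧
      (∀ k ≥ kb,
        c + σ k • (‖d‖⁻¹ • d) ∈
          interior {y : EuclideanSpace ℝ (Fin n) | psiG ψ (γ k) y ≤ -(alph η Mb (γ k))}) := by
  intro c hc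
  set U : Set (EuclideanSpace ℝ (Fin n)) := {y | ∃ c ∈ C, dist y c < ρ} with hU
  have hUo : IsOpen U := by
    have : U = ⋃ c ∈ C, ball c ρ := by ext; simp [hU]
    rw [this]
    exact isOpen_biUnion fun _ _ => isOpen_ball
  have hcC : c ∈ C := hCcp.isClosed.frontier_subset hc
  have hcU : c ∈ U := ⟨c, hcC, by simpa using hρ⟩
  have hUc : U ∈ nhds c := hUo.mem_nhds hcU
  have hcont : ∀ y ∈ U, ∀ i, ContinuousAt (ψ i) y := fun y hy i => (hdiff i y hy).continuousAt
  have hact : ∃ i, ψ i c = 0 := by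
    by_contra! hne
    have hle : ∀ i, ψ i c ≤ 0 := by simpa [hCdef] using hcC
    refine hc.2 (mem_interior_iff_mem_nhds.2 ?_)
    have : ∀ᶠ y in nhds c, ∀ i, ψ i y < 0 := eventually_all.2 fun i =>
      (hcont c hcU i).eventually_lt continuousAt_const (lt_of_le_of_ne (hle i) (hne i))
    filter_upwards [this] with y hy
    simpa [hCdef] using fun i => (hy i).le
  obtain ⟨u, hu1, hu⟩ := exists_unit_inner_lt_of_convexComb_norm_gt (fun i => ψ' i c)
    (fun i => ψ i c = 0) (by positivity) hact (hA22 c hcC)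
  have hstrict : ∀ i, HasStrictFDerivAt (ψ i) (innerSL ℝ (ψ' i c)) c := by
    intro i
    obtain ⟨L, hL⟩ := hlip i
    refine hasStrictFDerivAt_of_hasFDerivAt_of_continuousAt
      (f' := fun x => innerSL ℝ (ψ' i x)) ?_ ?_
    · filter_upwards [hUc] with x hx using (hdiff i x hx).hasFDerivAt
    · exact (innerSL ℝ).continuous.continuousAt.comp (hL.continuousOn.continuousAt hUc)
  have hnear : ∀ᶠ q in nhds (c, c), ∀ i : Fin r, q.1 ∈ U ∧
      (ψ i c = 0 → ψ i q.1 - ψ i q.2 - ⟪ψ' i c, q.1 - q.2⟫ ≤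
        (-(2 * η) - ⟪ψ' i c, u⟫) * ‖q.1 - q.2‖) ∧
      (ψ i c < 0 → ψ i q.1 < ψ i c / 2) := by
    refine eventually_all.2 fun i => ?_
    refine (continuousAt_fst.eventually_mem hUc).and (Eventually.and ?_ ?_)
    · by_cases h0 : ψ i c = 0
      · have hpos : 0 < -(2 * η) - ⟪ψ' i c, u⟫ := by linarith [hu i h0]
        filter_upwards [(hstrict i).isLittleO.def hpos] with q hq _
        exact (le_abs_self _).trans hq
      · exact Eventually.of_forall fun _ h => absurd h h0
    · by_cases h0 : ψ i c < 0
      · have h1 : ContinuousAt (fun q : EuclideanSpace ℝ (Fin n) × EuclideanSpace ℝ (Fin n) =>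
            ψ i q.1) (c, c) :=
          ContinuousAt.comp (f := Prod.fst) (hcont c hcU i) continuousAt_fst
        filter_upwards [h1.eventually_lt (continuousAt_const (y := ψ i c / 2)) (by
          change ψ i c < ψ i c / 2
          linarith)] with q hq _ using hq
      · exact Eventually.of_forall fun _ h => absurd h h0
  obtain ⟨δ, hδ, hball⟩ := Metric.eventually_nhds_iff.1 hnear
  have hαt : Tendsto (fun k => alph η Mb (γ k)) atTop (nhds 0) :=
    (tendsto_alph_atTop hη hMb).comp hγtop
  have hlt : Tendsto (fun k => Real.log r / γ k) atTop (nhds 0) := hγtop.const_div_atTop _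
  have hsumt : Tendsto (fun k => Real.log r / γ k + alph η Mb (γ k)) atTop (nhds 0) := by
    simpa using hlt.add hαt
  have hσt : Tendsto σ atTop (nhds 0) := by
    rw [funext hσ]
    simpa using hsumt.const_mul (r * Mψ / (2 * η ^ 2))
  have hinact : ∀ᶠ k in atTop, ∀ i, ψ i c < 0 →
      Real.log r / γ k + alph η Mb (γ k) < -(ψ i c / 2) := by
    refine eventually_all.2 fun i => ?_
    by_cases h0 : ψ i c < 0
    · filter_upwards [hsumt.eventually_lt_const (show 0 < -(ψ i c / 2) by linarith)] with k hk _
        using hk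
    · exact Eventually.of_forall fun _ h => absurd h h0
  obtain ⟨kb, hkb⟩ := eventually_atTop.1
    ((hσt.eventually_lt_const (half_pos hδ)).and hinact)
  have hmain : ∀ k ≥ kb, ∀ x ∈ C ∩ closedBall c (δ / 2), x + σ k • (‖u‖⁻¹ • u) ∈
      interior {y : EuclideanSpace ℝ (Fin n) | psiG ψ (γ k) y ≤ -(alph η Mb (γ k))} := by
    rintro k hk x ⟨hxC, hxc⟩
    obtain ⟨hσδ, hin⟩ := hkb k hk
    have hγ0 : 0 < γ k := lt_trans (by positivity) (hγlb k)
    have hα : 0 < alph η Mb (γ k) := alph_pos hη hMb (hγlb k)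
    have hr1 : (1 : ℝ) ≤ r := by exact_mod_cast hr
    have hl : 0 ≤ Real.log r / γ k := div_nonneg (Real.log_nonneg hr1) hγ0.le
    have hσ2 : 2 * (Real.log r / γ k + alph η Mb (γ k)) ≤ 2 * η * σ k := by
      have hcoef : 2 ≤ 2 * η * (r * Mψ / (2 * η ^ 2)) := by
        have : 2 * η * (r * Mψ / (2 * η ^ 2)) = r * Mψ / η := by field_simp
        rw [this, le_div_iff₀ hη]
        nlinarith
      rw [hσ, ← mul_assoc]
      gcongr
    have hσ0 : 0 < σ k := by
      by_contra! hneg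
      nlinarith
    rw [hu1, inv_one, one_smul]
    set y := x + σ k • u with hy
    have hyx : y - x = σ k • u := by simp [hy]
    have hynorm : ‖y - x‖ = σ k := by
      rw [hyx, norm_smul, hu1, mul_one, Real.norm_of_nonneg hσ0.le]
    have hxc' : dist x c ≤ δ / 2 := hxc
    have hyc : dist y c < δ := by
      have := dist_triangle y x c
      rw [dist_eq_norm y x, hynorm] at this
      linarith
    have hq := hball (y := (y, x)) (by
      rw [Prod.dist_eq]
      exact max_lt hyc (by linarith))
    have hyU : y ∈ U := (hq ⟨0, hr⟩).1
    have hψy : ∀ i, ψ i y < -(Real.log r / γ k) - alph η Mb (γ k) := by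
      intro i
      have hxi : ψ i x ≤ 0 := by
        rw [hCdef] at hxC
        exact mem_iInter.1 hxC i
      have hci : ψ i c ≤ 0 := by
        rw [hCdef] at hcC
        exact mem_iInter.1 hcC i
      obtain ⟨-, h1, h2⟩ := hq i
      rcases hci.lt_or_eq with h0 | h0
      · linarith [h2 h0, hin i h0]
      · have h3 := h1 h0
        simp only [hynorm] at h3
        rw [hyx, inner_smul_right] at h3
        linarith
    rw [mem_interior_iff_mem_nhds]
    have : Nonempty (Fin r) := ⟨⟨0, hr⟩⟩
    obtain ⟨i₀, hi₀⟩ := Finite.exists_max fun i => ψ i y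
    have hlt' : psiG ψ (γ k) y < -(alph η Mb (γ k)) := by
      linarith [psiG_le_add_log_div hr ψ hγ0 hi₀, hψy i₀]
    filter_upwards [(continuousAt_psiG hr (γ k) (hcont y hyU)).eventually_lt
      continuousAt_const hlt'] with z hz using hz.le
  have hu0 : u ≠ 0 := by
    rintro rfl
    simp at hu1
  exact ⟨kb, δ / 2, half_pos hδ, u, hu0, hmain, fun k hk =>
    hmain k hk c ⟨hcC, mem_closedBall_self (half_pos hδ).le⟩⟩
end
end

section
/- Under (A2.1) and (A2.2), with C nonempty and compact, for every c in the topological boundary of C there exists a vector d_c ∈ ℝⁿ such that 4η²/M̄_ψ ≤ ‖d_c‖ ≤ r·M̄_ψ (in particular d_c ≠ 0) and ⟨d_c/‖d_c‖, ∇ψ_i(c)⟩ ≤ −4η²/(r·M̄_ψ) for every index i in the active set I⁰_c = {i : ψ_i(c) = 0}. -/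
open Metric Set
open scoped BigOperators RealInnerProductSpace

noncomputable section

/-- Some convex combination `v` of the vectors `g i` with `p i` (the one of least norm) satisfies
`‖v‖ ^ 2 ≤ ⟪v, g i⟫` for all `i` with `p i`. -/
lemma exists_convexCombination_norm_sq_le_inner {ι E : Type*} [Fintype ι]
    [NormedAddCommGroup E] [InnerProductSpace ℝ E] (g : ι → E) (p : ι → Prop) (hp : ∃ i, p i) :
    ∃ lam : ι → ℝ, (∀ i, 0 ≤ lam i) ∧ (∀ i, ¬ p i → lam i = 0) ∧ ∑ i, lam i = 1 ∧
      ∀ i, p i → ‖∑ j, lam j • g j‖ ^ 2 ≤ ⟪∑ j, lam j • g j, g i⟫ := by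
  classical
  let S : Set (ι → ℝ) := stdSimplex ℝ ι ∩ {lam | ∀ i, ¬ p i → lam i = 0}
  let T : (ι → ℝ) →ₗ[ℝ] E := Fintype.linearCombination ℝ g
  have hT (lam : ι → ℝ) : T lam = ∑ i, lam i • g i := rfl
  have hcont : Continuous T := by
    simp only [funext hT]
    fun_prop
  have hclosed : IsClosed {lam : ι → ℝ | ∀ i, ¬ p i → lam i = 0} := by
    simp only [ofPred_forall]
    exact isClosed_iInter fun i ↦ isClosed_iInter fun _ ↦
      isClosed_eq (continuous_apply i) continuous_const
  have hconv : Convex ℝ {lam : ι → ℝ | ∀ i, ¬ p i → lam i = 0} := by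
    intro x hx y hy a b _ _ _ i hi
    simp [hx i hi, hy i hi]
  have hSconv : Convex ℝ (T '' S) :=
    ((convex_stdSimplex ℝ ι).inter hconv).linear_image T
  have hScomp : IsComplete (T '' S) :=
    (((isCompact_stdSimplex ℝ ι).inter_right hclosed).image hcont).isComplete
  have hsingle (i : ι) (hi : p i) : g i ∈ T '' S := by
    refine ⟨Pi.single i 1, ⟨single_mem_stdSimplex ℝ i, fun j hj ↦ ?_⟩, ?_⟩
    · exact Pi.single_eq_of_ne (by rintro rfl; exact hj hi) _
    · simp [T]
  obtain ⟨i₀, hi₀⟩ := hp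
  obtain ⟨v, hv, hmin⟩ :=
    exists_norm_eq_iInf_of_complete_convex ⟨_, hsingle i₀ hi₀⟩ hScomp hSconv 0
  have hinner := (norm_eq_iInf_iff_real_inner_le_zero hSconv hv).1 hmin
  obtain ⟨lam, ⟨⟨hnn, hsum⟩, hzero⟩, rfl⟩ := hv
  refine ⟨lam, hnn, hzero, hsum, fun i hi ↦ ?_⟩
  have h := hinner (g i) (hsingle i hi)
  rw [zero_sub, inner_neg_left, inner_sub_right, real_inner_self_eq_norm_sq] at h
  rw [← hT]
  linarith

/-- At a frontier point of a finite intersection of sublevel sets of functions continuous there,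
some constraint is not strictly satisfied. -/
lemma exists_nonneg_of_mem_frontier_iInter {ι X : Type*} [Finite ι] [TopologicalSpace X]
    {f : ι → X → ℝ} {c : X} (hf : ∀ i, ContinuousAt (f i) c)
    (hc : c ∈ frontier (⋂ i, {x | f i x ≤ 0})) : ∃ i, 0 ≤ f i c := by
  by_contra! h
  refine hc.2 (mem_interior_iff_mem_nhds.2 ?_)
  rw [Filter.iInter_mem]
  intro i
  filter_upwards [(hf i).eventually_lt_const (h i)] with x hx using hx.le

theorem stmt_11 {n r : ℕ} (hn : 0 < n) (hr : 0 < r)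
    (ψ : Fin r → EuclideanSpace ℝ (Fin n) → ℝ)
    (ψ' : Fin r → EuclideanSpace ℝ (Fin n) → EuclideanSpace ℝ (Fin n))
    (C : Set (EuclideanSpace ℝ (Fin n)))
    (hCdef : C = ⋂ i, {x | ψ i x ≤ 0})
    (hCne : C.Nonempty) (hCcp : IsCompact C)
    -- (A2.1)
    (ρ : ℝ) (hρ : 0 < ρ)
    (hdiff : ∀ i, ∀ x ∈ {y | ∃ c ∈ C, dist y c < ρ}, HasGradientAt (ψ i) (ψ' i x) x)
    (hlip : ∀ i, ∃ L : NNReal, LipschitzOnWith L (ψ' i) {y | ∃ c ∈ C, dist y c < ρ})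
    -- (A2.2)
    (η : ℝ) (hη : 0 < η)
    (hA22 : ∀ c ∈ C, ∀ lam : Fin r → ℝ, (∀ i, 0 ≤ lam i) →
      (∀ i, ψ i c ≠ 0 → lam i = 0) → (∑ i, lam i) = 1 →
      2 * η < ‖∑ i, lam i • ψ' i c‖)
    -- bound on the gradients
    (Mψ : ℝ) (hMψη : 2 * η ≤ Mψ) (hMψ : ∀ i, ∀ x ∈ C, ‖ψ' i x‖ ≤ Mψ) :
    ∀ c ∈ frontier C, ∃ d : EuclideanSpace ℝ (Fin n),
      d ≠ 0 ∧ 4 * η ^ 2 / Mψ ≤ ‖d‖ ∧ ‖d‖ ≤ r * Mψ ∧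
      ∀ i : Fin r, ψ i c = 0 →
        ⟪‖d‖⁻¹ • d, ψ' i c⟫ ≤ -(4 * η ^ 2 / (r * Mψ)) := by
  intro c hc
  have hcC : c ∈ C := hCcp.isClosed.frontier_subset hc
  have hle : ∀ i, ψ i c ≤ 0 := by simpa [hCdef] using hcC
  have hψc (i : Fin r) : ContinuousAt (ψ i) c :=
    (hdiff i c ⟨c, hcC, by simpa using hρ⟩).continuousAt
  obtain ⟨i₀, hi₀⟩ := exists_nonneg_of_mem_frontier_iInter hψc (hCdef ▸ hc)
  obtain ⟨lam, hnn, hzero, hsum, hinner⟩ := exists_convexCombination_norm_sq_le_inner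
    (fun i ↦ ψ' i c) (fun i ↦ ψ i c = 0) ⟨i₀, (hle i₀).antisymm hi₀⟩
  have hlow := hA22 c hcC lam hnn hzero hsum
  have hupp : ‖∑ i, lam i • ψ' i c‖ ≤ Mψ := by
    calc ‖∑ i, lam i • ψ' i c‖ ≤ ∑ i, lam i * Mψ := norm_sum_le_of_le _ fun i _ ↦ by
          rw [norm_smul, Real.norm_of_nonneg (hnn i)]
          exact mul_le_mul_of_nonneg_left (hMψ i c hcC) (hnn i)
      _ = Mψ := by rw [← Finset.sum_mul, hsum, one_mul]
  set v := ∑ i, lam i • ψ' i c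
  have hvpos : 0 < ‖v‖ := by linarith
  have hM : 0 < Mψ := by linarith
  have hr1 : (1 : ℝ) ≤ r := by exact_mod_cast hr
  have hMr : Mψ ≤ r * Mψ := le_mul_of_one_le_left hM.le hr1
  have hquot : 4 * η ^ 2 / Mψ ≤ 2 * η := by
    rw [div_le_iff₀ hM]
    nlinarith
  have hquot_r : 4 * η ^ 2 / (r * Mψ) ≤ 4 * η ^ 2 / Mψ := by gcongr
  refine ⟨-v, neg_ne_zero.2 (norm_pos_iff.1 hvpos), ?_, ?_, fun i hi ↦ ?_⟩
  · rw [norm_neg]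
    linarith
  · rw [norm_neg]
    linarith
  · have h : ‖v‖ ≤ ‖v‖⁻¹ * ⟪v, ψ' i c⟫ := by
      rw [inv_mul_eq_div, le_div_iff₀ hvpos, ← sq]
      exact hinner i hi
    rw [norm_neg, smul_neg, inner_neg_left, real_inner_smul_left]
    linarith
end
end

section
/- Assume (A2.1) and (A2.2) (C not necessarily bounded but nonempty and closed). Let y_o ∈ ℝⁿ and R_o > 0, and define ψ_{r+1}(x) := (1/2)(‖x − y_o‖² − R_o²), so that ∇ψ_{r+1}(x) = x − y_o. Assume that for every c in the topological boundary of C with ‖c − y_o‖ = R_o, the unit vector (y_o − c)/‖y_o − c‖ is not a proximal normal direction to C at c. Then the extended family (ψ_i)_{i=1}^{r+1} satisfies assumption (A2.2) on Ĉ := C ∩ B̄_{R_o}(y_o): there exists η̂ > 0 such that for every c ∈ Ĉ whose extended active index set Î⁰_c := {i ∈ {1,…,r+1} : ψ_i(c) = 0} is nonempty, and every nonnegative reals (λ_i)_{i∈Î⁰_c} with Σ_{i∈Î⁰_c} λ_i = 1, one has ‖Σ_{i∈Î⁰_c} λ_i ∇ψ_i(c)‖ > 2η̂. -/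
open Metric Set
open scoped BigOperators

noncomputable section

/-- Quadratic lower estimate at a zero of a function with Lipschitz gradient: a nearby point of the
sublevel set makes an almost obtuse angle with the gradient. -/
lemma inner_gradient_sub_le_of_nonpos {E : Type*} [NormedAddCommGroup E] [InnerProductSpace ℝ E]
    [CompleteSpace E] {f : E → ℝ} {f' : E → E} {U : Set E} {L : NNReal} {c x : E} {δ : ℝ}
    (hU : ball c δ ⊆ U) (hf : ∀ z ∈ U, HasGradientAt f (f' z) z) (hL : LipschitzOnWith L f' U)
    (hx : ‖x - c‖ < δ) (hc0 : f c = 0) (hx0 : f x ≤ 0) :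
    inner ℝ (f' c) (x - c) ≤ L * ‖x - c‖ ^ 2 := by
  have hsub : closedBall c ‖x - c‖ ⊆ U := (closedBall_subset_ball hx).trans hU
  have hcU : c ∈ U := hsub (mem_closedBall_self (norm_nonneg _))
  have hbound : ∀ z ∈ closedBall c ‖x - c‖,
      ‖InnerProductSpace.toDual ℝ E (f' z) - InnerProductSpace.toDual ℝ E (f' c)‖
        ≤ L * ‖x - c‖ := by
    intro z hz
    rw [← map_sub, LinearIsometryEquiv.norm_map]
    refine (hL.norm_sub_le (hsub hz) hcU).trans ?_
    gcongr
    rwa [← dist_eq_norm]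
  have key := (convex_closedBall c ‖x - c‖).norm_image_sub_le_of_norm_hasFDerivWithin_le'
    (fun z hz => (hf z (hsub hz)).hasFDerivAt.hasFDerivWithinAt) hbound
    (mem_closedBall_self (norm_nonneg _)) (by rw [mem_closedBall, dist_eq_norm])
  rw [InnerProductSpace.toDual_apply_apply, Real.norm_eq_abs] at key
  nlinarith [neg_abs_le (f x - f c - inner ℝ (f' c) (x - c))]

/-- If `⟪ζ, x - c⟫ ≤ K * ‖x - c‖ ^ 2` for all `x ∈ C` near `c`, then the unit vector `ζ` is a
proximal normal direction to `C` at `c`. -/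
lemma exists_ball_inter_eq_empty_of_inner_le {E : Type*} [NormedAddCommGroup E]
    [InnerProductSpace ℝ E] {C : Set E} {c ζ : E} {K δ : ℝ} (hζ : ‖ζ‖ = 1) (hδ : 0 < δ)
    (h : ∀ x ∈ C, ‖x - c‖ < δ → inner ℝ ζ (x - c) ≤ K * ‖x - c‖ ^ 2) :
    ∃ ε : ℝ, 0 < ε ∧ ball (c + ε • ζ) ε ∩ C = ∅ := by
  have hK : 0 < 2 * (|K| + 1) := by positivity
  refine ⟨min (δ / 2) (1 / (2 * (|K| + 1))), by positivity, ?_⟩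
  set ε := min (δ / 2) (1 / (2 * (|K| + 1)))
  have hε0 : 0 < ε := by positivity
  have hε1 : ε ≤ δ / 2 := min_le_left _ _
  have hε2 : ε * (2 * (|K| + 1)) ≤ 1 := (le_div_iff₀ hK).1 (min_le_right _ _)
  rw [eq_empty_iff_forall_notMem]
  rintro x ⟨hxb, hxC⟩
  rw [mem_ball, dist_eq_norm, ← sub_sub] at hxb
  have hnorm : ‖ε • ζ‖ = ε := by rw [norm_smul, hζ, mul_one, Real.norm_of_nonneg hε0.le]
  have hlt : ‖x - c‖ < δ := by
    have := norm_sub_norm_le (x - c) (ε • ζ)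
    linarith
  have hsq : ‖x - c - ε • ζ‖ ^ 2 < ε ^ 2 := by gcongr
  rw [norm_sub_sq_real, hnorm, real_inner_smul_right, real_inner_comm] at hsq
  have hin := mul_le_mul_of_nonneg_left (h x hxC hlt) hε0.le
  have hK' : ε * K * ‖x - c‖ ^ 2 ≤ ε * |K| * ‖x - c‖ ^ 2 := by
    gcongr
    exact le_abs_self K
  nlinarith [mul_le_mul_of_nonneg_right hε2 (sq_nonneg ‖x - c‖),
    mul_nonneg hε0.le (sq_nonneg ‖x - c‖)]

/-- A point of `C` lying on the boundary sphere of a ball disjoint from `C` is a frontier point. -/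
lemma mem_frontier_of_ball_inter_eq_empty {E : Type*} [NormedAddCommGroup E] [NormedSpace ℝ E]
    {C : Set E} {c ζ : E} {ε : ℝ} (hζ : ‖ζ‖ = 1) (hε : 0 < ε) (hc : c ∈ C)
    (h : ball (c + ε • ζ) ε ∩ C = ∅) : c ∈ frontier C := by
  rw [frontier_eq_closure_inter_closure]
  refine ⟨subset_closure hc,
    closure_mono (disjoint_iff_inter_eq_empty.2 h).subset_compl_right ?_⟩
  rw [closure_ball _ hε.ne', mem_closedBall, dist_eq_norm]
  simp [norm_smul, hζ, abs_of_pos hε]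

/-- A continuous vector combination that vanishes at no admissible triple of a point of a compact
set and complementary weights in the simplex is bounded away from zero on these triples. -/
lemma exists_pos_lt_norm_of_complementarity {E ι : Type*} [NormedAddCommGroup E] [NormedSpace ℝ E]
    [Fintype ι] {S : Set E} (hS : IsCompact S) {φ : ι → E → ℝ} {g : E → ℝ} {φ' : ι → E → E}
    {g' : E → E} (hφ : ∀ i, ContinuousOn (φ i) S) (hg : ContinuousOn g S)
    (hφ' : ∀ i, ContinuousOn (φ' i) S) (hg' : ContinuousOn g' S)
    (hne : ∀ c ∈ S, ∀ lam : ι → ℝ, ∀ μ : ℝ, (∀ i, 0 ≤ lam i) → 0 ≤ μ →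
      (∀ i, φ i c ≠ 0 → lam i = 0) → (g c ≠ 0 → μ = 0) → (∑ i, lam i) + μ = 1 →
      (∑ i, lam i • φ' i c) + μ • g' c ≠ 0) :
    ∃ m : ℝ, 0 < m ∧ ∀ c ∈ S, ∀ lam : ι → ℝ, ∀ μ : ℝ, (∀ i, 0 ≤ lam i) → 0 ≤ μ →
      (∀ i, φ i c ≠ 0 → lam i = 0) → (g c ≠ 0 → μ = 0) → (∑ i, lam i) + μ = 1 →
      2 * m < ‖(∑ i, lam i • φ' i c) + μ • g' c‖ := by
  set T : Set (E × (ι → ℝ) × ℝ) := S ×ˢ (Icc 0 1 ×ˢ Icc 0 1)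
  have hTc : IsCompact T := hS.prod (isCompact_Icc.prod isCompact_Icc)
  have hfst : MapsTo (Prod.fst : E × (ι → ℝ) × ℝ → E) T S := fun p hp => hp.1
  have hcoord : ∀ i, ContinuousOn (fun p : E × (ι → ℝ) × ℝ => p.2.1 i) T :=
    fun i => Continuous.continuousOn (by fun_prop)
  have hlast : ContinuousOn (fun p : E × (ι → ℝ) × ℝ => p.2.2) T :=
    Continuous.continuousOn (by fun_prop)
  set F : E × (ι → ℝ) × ℝ → (ι → ℝ) × ℝ × ℝ :=
    fun p => (fun i => p.2.1 i * φ i p.1, p.2.2 * g p.1, (∑ i, p.2.1 i) + p.2.2) with hF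
  have hFc : ContinuousOn F T := by
    refine ContinuousOn.prodMk (continuousOn_pi.2 fun i => ?_) (ContinuousOn.prodMk ?_ ?_)
    · exact (hcoord i).mul ((hφ i).comp continuousOn_fst hfst)
    · exact hlast.mul (hg.comp continuousOn_fst hfst)
    · exact Continuous.continuousOn (by fun_prop)
  have hKc : IsCompact (T ∩ F ⁻¹' {(0, 0, 1)}) :=
    hTc.of_isClosed_subset
      (hFc.preimage_isClosed_of_isClosed hTc.isClosed isClosed_singleton) inter_subset_left
  have hGc : ContinuousOn (fun p : E × (ι → ℝ) × ℝ =>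
      ‖(∑ i, p.2.1 i • φ' i p.1) + p.2.2 • g' p.1‖) (T ∩ F ⁻¹' {(0, 0, 1)}) := by
    refine ContinuousOn.mono (ContinuousOn.norm (ContinuousOn.add ?_ ?_)) inter_subset_left
    · exact continuousOn_finsetSum _ fun i _ =>
        (hcoord i).smul ((hφ' i).comp continuousOn_fst hfst)
    · exact hlast.smul (hg'.comp continuousOn_fst hfst)
  obtain ⟨m, hm, hmle⟩ := hKc.exists_forall_le' hGc (a := 0) (by
    rintro ⟨c, lam, μ⟩ ⟨⟨hc, hlam, hμ⟩, hFeq⟩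
    simp only [hF, mem_preimage, mem_singleton_iff, Prod.mk.injEq, funext_iff, Pi.zero_apply,
      mul_eq_zero] at hFeq
    exact norm_pos_iff.2 (hne c hc lam μ hlam.1 hμ.1 (fun i => (hFeq.1 i).resolve_right)
      hFeq.2.1.resolve_right hFeq.2.2))
  refine ⟨m / 4, by positivity, fun c hc lam μ hlam hμ hcl hcm hsum => ?_⟩
  have hle : ∀ i, lam i ≤ 1 := fun i => by
    linarith [Finset.single_le_sum (fun j _ => hlam j) (Finset.mem_univ i)]
  have hμ1 : μ ≤ 1 := by linarith [Finset.sum_nonneg fun i (_ : i ∈ Finset.univ) => hlam i]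
  have := hmle (c, lam, μ) ⟨⟨hc, ⟨hlam, hle⟩, hμ, hμ1⟩, by
    simp only [hF, mem_preimage, mem_singleton_iff, Prod.mk.injEq, funext_iff, Pi.zero_apply,
      mul_eq_zero]
    exact ⟨fun i => or_iff_not_imp_right.2 (hcl i), or_iff_not_imp_right.2 hcm, hsum⟩⟩
  dsimp only at this
  linarith

theorem stmt_16 {n r : ℕ} (hn : 0 < n) (hr : 0 < r)
    (ψ : Fin r → EuclideanSpace ℝ (Fin n) → ℝ)
    (ψ' : Fin r → EuclideanSpace ℝ (Fin n) → EuclideanSpace ℝ (Fin n))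
    (C : Set (EuclideanSpace ℝ (Fin n)))
    (hCdef : C = ⋂ i, {x | ψ i x ≤ 0})
    (hCne : C.Nonempty) (hCcl : IsClosed C)
    -- (A2.1)
    (ρ : ℝ) (hρ : 0 < ρ)
    (hdiff : ∀ i, ∀ x ∈ {y | ∃ c ∈ C, dist y c < ρ}, HasGradientAt (ψ i) (ψ' i x) x)
    (hlip : ∀ i, ∃ L : NNReal, LipschitzOnWith L (ψ' i) {y | ∃ c ∈ C, dist y c < ρ})
    -- (A2.2)
    (η : ℝ) (hη : 0 < η)
    (hA22 : ∀ c ∈ C, ∀ lam : Fin r → ℝ, (∀ i, 0 ≤ lam i) →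
      (∀ i, ψ i c ≠ 0 → lam i = 0) → (∑ i, lam i) = 1 →
      2 * η < ‖∑ i, lam i • ψ' i c‖)
    -- the extra ball constraint
    (y₀ : EuclideanSpace ℝ (Fin n)) (R₀ : ℝ) (hR₀ : 0 < R₀)
    -- (A2.4)(i): no proximal normal direction pointing at y₀ on the boundary sphere
    (hprox : ∀ c ∈ frontier C, ‖c - y₀‖ = R₀ →
      ∀ ρ' : ℝ, 0 < ρ' →
        (ball (c + ρ' • (‖y₀ - c‖⁻¹ • (y₀ - c))) ρ' ∩ C).Nonempty) :
    -- (A2.2) for the extended family (ψ₁, …, ψ_r, ψ_{r+1}) on Ĉ = C ∩ B̄_{R₀}(y₀),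
    -- where ψ_{r+1} x = (‖x - y₀‖² - R₀²)/2 and ∇ψ_{r+1} x = x - y₀
    ∃ ηh : ℝ, 0 < ηh ∧
      ∀ c ∈ C ∩ closedBall y₀ R₀, ∀ lam : Fin r → ℝ, ∀ μ : ℝ,
        (∀ i, 0 ≤ lam i) → 0 ≤ μ →
        (∀ i, ψ i c ≠ 0 → lam i = 0) →
        ((1 / 2 : ℝ) * (‖c - y₀‖ ^ 2 - R₀ ^ 2) ≠ 0 → μ = 0) →
        ((∑ i, lam i) + μ = 1) →
        2 * ηh < ‖(∑ i, lam i • ψ' i c) + μ • (c - y₀)‖ := by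
  have hCU : C ⊆ {y | ∃ c ∈ C, dist y c < ρ} := fun c hc => ⟨c, hc, by simpa using hρ⟩
  choose L hL using hlip
  refine exists_pos_lt_norm_of_complementarity
    (g := fun c => (1 / 2 : ℝ) * (‖c - y₀‖ ^ 2 - R₀ ^ 2)) (g' := fun c => c - y₀)
    ((isCompact_closedBall y₀ R₀).inter_left hCcl)
    (fun i c hc => (hdiff i c (hCU hc.1)).hasFDerivAt.continuousAt.continuousWithinAt)
    (Continuous.continuousOn (by fun_prop))
    (fun i => (hL i).continuousOn.mono (inter_subset_left.trans hCU))
    (Continuous.continuousOn (by fun_prop)) ?_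
  rintro c ⟨hc, -⟩ lam μ hlam hμ hcl hcm hsum h0
  rcases hμ.eq_or_lt with rfl | hμ
  · have hlow := hA22 c hc lam hlam hcl (by simpa using hsum)
    rw [zero_smul, add_zero] at h0
    rw [h0, norm_zero] at hlow
    linarith
  have hR : ‖c - y₀‖ = R₀ := by
    have hsq : ‖c - y₀‖ ^ 2 = R₀ ^ 2 := by
      by_contra hcon
      exact hμ.ne' (hcm (mul_ne_zero (by norm_num) (sub_ne_zero.2 hcon)))
    exact (sq_eq_sq₀ (norm_nonneg _) hR₀.le).1 hsq
  have hR' : ‖y₀ - c‖ = R₀ := by rw [norm_sub_rev, hR]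
  have hζ : ‖‖y₀ - c‖⁻¹ • (y₀ - c)‖ = 1 :=
    norm_smul_inv_norm (𝕜 := ℝ) (norm_pos_iff.1 (hR'.symm ▸ hR₀))
  have hcomb : ∑ i, lam i • ψ' i c = μ • (y₀ - c) := by
    rw [eq_neg_of_add_eq_zero_left h0, ← smul_neg, neg_sub]
  have hmain : ∀ x ∈ C, ‖x - c‖ < ρ →
      inner ℝ (‖y₀ - c‖⁻¹ • (y₀ - c)) (x - c)
        ≤ R₀⁻¹ * (μ⁻¹ * ∑ i, lam i * L i) * ‖x - c‖ ^ 2 := by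
    intro x hx hxc
    have hterm : ∀ i, lam i * inner ℝ (ψ' i c) (x - c) ≤ lam i * (L i * ‖x - c‖ ^ 2) := by
      intro i
      by_cases hi : ψ i c = 0
      · refine mul_le_mul_of_nonneg_left ?_ (hlam i)
        refine inner_gradient_sub_le_of_nonpos (fun z hz => ?_) (hdiff i) (hL i) hxc hi ?_
        · exact ⟨c, hc, hz⟩
        rw [hCdef] at hx
        exact mem_iInter.1 hx i
      · simp [hcl i hi]
    have hsumle : μ * inner ℝ (y₀ - c) (x - c) ≤ (∑ i, lam i * L i) * ‖x - c‖ ^ 2 := by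
      rw [← real_inner_smul_left, ← hcomb, sum_inner, Finset.sum_mul]
      refine Finset.sum_le_sum fun i _ => ?_
      rw [real_inner_smul_left, mul_assoc]
      exact hterm i
    rw [real_inner_smul_left, hR', mul_assoc, mul_assoc]
    refine mul_le_mul_of_nonneg_left ?_ (inv_nonneg.2 hR₀.le)
    rwa [le_inv_mul_iff₀ hμ]
  obtain ⟨ε, hε, hempty⟩ := exists_ball_inter_eq_empty_of_inner_le hζ hρ hmain
  exact (hprox c (mem_frontier_of_ball_inter_eq_empty hζ hε hc hempty) hR ε hε).ne_empty hempty
end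
end

section
/- Under (A2.1) and (A2.2), with C nonempty and compact, there exists ε > 0 such that for every i ∈ {1,…,r} and every x ∈ C with ‖∇ψ_i(x)‖ ≤ η, one has ψ_i(x) < −ε. -/
open Metric Set
open scoped BigOperators

noncomputable section

/-- A continuous real function that is negative on a compact set is bounded above there by
every sufficiently small negative number. -/
theorem eventually_forall_lt_neg_of_isCompact {X : Type*} [TopologicalSpace X] {K : Set X}
    (hK : IsCompact K) {f : X → ℝ} (hf : ContinuousOn f K) (hneg : ∀ x ∈ K, f x < 0) :
    ∀ᶠ ε in nhdsWithin (0 : ℝ) (Ioi 0), ∀ x ∈ K, f x < -ε := by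
  rcases K.eq_empty_or_nonempty with rfl | hne
  · simp
  obtain ⟨x₀, hx₀, hmax⟩ := hK.exists_isMaxOn hne hf
  filter_upwards [Ioo_mem_nhdsGT (neg_pos.2 (hneg x₀ hx₀))] with ε hε x hx
  have hle : f x ≤ f x₀ := hmax hx
  linarith [hε.2]

theorem stmt_17 {n r : ℕ} (hn : 0 < n) (hr : 0 < r)
    (ψ : Fin r → EuclideanSpace ℝ (Fin n) → ℝ)
    (ψ' : Fin r → EuclideanSpace ℝ (Fin n) → EuclideanSpace ℝ (Fin n))
    (C : Set (EuclideanSpace ℝ (Fin n)))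
    (hCdef : C = ⋂ i, {x | ψ i x ≤ 0})
    (hCne : C.Nonempty) (hCcp : IsCompact C)
    -- (A2.1)
    (ρ : ℝ) (hρ : 0 < ρ)
    (hdiff : ∀ i, ∀ x ∈ {y | ∃ c ∈ C, dist y c < ρ}, HasGradientAt (ψ i) (ψ' i x) x)
    (hlip : ∀ i, ∃ L : NNReal, LipschitzOnWith L (ψ' i) {y | ∃ c ∈ C, dist y c < ρ})
    -- (A2.2)
    (η : ℝ) (hη : 0 < η)
    (hA22 : ∀ c ∈ C, ∀ lam : Fin r → ℝ, (∀ i, 0 ≤ lam i) →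
      (∀ i, ψ i c ≠ 0 → lam i = 0) → (∑ i, lam i) = 1 →
      2 * η < ‖∑ i, lam i • ψ' i c‖) :
    ∃ ε > (0:ℝ), ∀ i : Fin r, ∀ x ∈ C, ‖ψ' i x‖ ≤ η → ψ i x < -ε := by
  have hball : ∀ x ∈ C, x ∈ {y | ∃ c ∈ C, dist y c < ρ} := fun x hx => ⟨x, hx, by simpa using hρ⟩
  have hev : ∀ i, ∀ᶠ ε in nhdsWithin (0 : ℝ) (Ioi 0),
      ∀ x ∈ C ∩ {x | ‖ψ' i x‖ ≤ η}, ψ i x < -ε := by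
    intro i
    obtain ⟨L, hL⟩ := hlip i
    have hcont : ContinuousOn (ψ' i) C := hL.continuousOn.mono hball
    have hK : IsCompact (C ∩ {x | ‖ψ' i x‖ ≤ η}) :=
      hCcp.of_isClosed_subset
        (hcont.norm.preimage_isClosed_of_isClosed hCcp.isClosed isClosed_Iic) inter_subset_left
    refine eventually_forall_lt_neg_of_isCompact hK
      (fun x hx => (hdiff i x (hball x hx.1)).continuousAt.continuousWithinAt) ?_
    rintro x ⟨hxC, hxη⟩
    have hle : ψ i x ≤ 0 := by
      rw [hCdef] at hxC
      exact mem_iInter.1 hxC i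
    refine lt_of_le_of_ne hle fun h0 => ?_
    have hlt := hA22 x hxC (Pi.single i 1)
      (fun j => by by_cases h : j = i <;> simp [h])
      (fun j hj => Pi.single_eq_of_ne (by rintro rfl; exact hj h0) 1)
      (by simp)
    simp only [Pi.single_apply, ite_smul, one_smul, zero_smul, Finset.sum_ite_eq',
      Finset.mem_univ, if_true] at hlt
    have hxη' : ‖ψ' i x‖ ≤ η := hxη
    linarith
  obtain ⟨ε, hε, hpos⟩ := ((Filter.eventually_all.2 hev).and self_mem_nhdsWithin).exists
  exact ⟨ε, hpos, fun i x hx hxη => hε i x ⟨hx, hxη⟩⟩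
end
end
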